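/- Let n ≥ 3, 1 < p < n, 0 ≤ γ ≤ p, and let Ω ⊆ ℝⁿ be a bounded connected open set such that ℝⁿ∖Ω is uniformly p-fat with constants c₀ and r₀. Let v ≥ 0 be a measurable function on Ω belonging to the weak Lebesgue space L^{n/γ,∞}(Ω), i.e. sup_{t>0} t · |{x ∈ Ω : v(x) > t}|^{γ/n} < ∞ (and v ∈ L^∞(Ω) when γ = 0). Then there exists C > 0 such that ∫_Ω |φ(x)|^p δ(x)^{−p+γ} v(x) dx ≤ C ∫_Ω |∇φ(x)|^p dx for all φ ∈ C_c^∞(Ω). -/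

import Mathlib

open MeasureTheory Metric
open scoped NNReal ENNReal

/-- The variational `p`-capacity of the condenser `(K, U)`: the infimum of `∫_U |∇φ|^p`
over Lipschitz functions `φ` with compact support contained in `U` with `φ ≥ 1` on `K`. -/
noncomputable def pCap (n : ℕ) (p : ℝ) (K U : Set (EuclideanSpace ℝ (Fin n))) : ℝ :=
  sInf { c : ℝ | ∃ φ : EuclideanSpace ℝ (Fin n) → ℝ, (∃ L : ℝ≥0, LipschitzWith L φ) ∧
    HasCompactSupport φ ∧ tsupport φ ⊆ U ∧ (∀ x ∈ K, 1 ≤ φ x) ∧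
    c = ∫ x in U, ‖fderiv ℝ φ x‖ ^ p }

/-- A closed set `E ⊆ ℝⁿ` is uniformly `p`-fat with constants `c₀, r₀ > 0` if
`cap_p(E ∩ B̄(x,r), B(x,2r)) ≥ c₀ · cap_p(B̄(x,r), B(x,2r))` for all `x ∈ ∂E`, `0 < r ≤ r₀`. -/
def UniformlyFat (n : ℕ) (p c₀ r₀ : ℝ) (E : Set (EuclideanSpace ℝ (Fin n))) : Prop :=
  ∀ x ∈ frontier E, ∀ r : ℝ, 0 < r → r ≤ r₀ →
    c₀ * pCap n p (closedBall x r) (ball x (2 * r)) ≤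
      pCap n p (E ∩ closedBall x r) (ball x (2 * r))

section

open Set Filter Topology

section Poincare

variable {E : Type*} [NormedAddCommGroup E] [NormedSpace ℝ E]

open Classical in
/-- The norm of the derivative of `u`, with the value `∞` where `u` is not differentiable. -/
noncomputable def extGradNorm (u : E → ℝ) (x : E) : ℝ≥0∞ :=
  if DifferentiableAt ℝ u x then ‖fderiv ℝ u x‖ₑ else ∞

lemma LipschitzWith.enorm_sub_le_lintegral {L : ℝ≥0} {u : E → ℝ} (hu : LipschitzWith L u)
    (y z : E) :
    ‖u z - u y‖ₑ ≤ ‖z - y‖ₑ * ∫⁻ t in Ioc (0 : ℝ) 1, extGradNorm u (y + t • (z - y)) := by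
  set h : ℝ → ℝ := fun t => u (y + t • (z - y)) with hh
  have hLip : LipschitzWith (L * ‖z - y‖₊) h := by
    refine LipschitzWith.of_dist_le_mul fun s t => (hu.dist_le_mul _ _).trans ?_
    rw [dist_add_left, dist_eq_norm (s • (z - y)), ← sub_smul, norm_smul, ← dist_eq_norm]
    push_cast
    rw [mul_assoc, mul_comm (dist s t)]
  have hac := (hLip.lipschitzOnWith (s := uIcc 0 1)).absolutelyContinuousOnInterval
  have hftc := hac.integral_deriv_eq_sub
  have h1 : h 1 = u z := by simp [hh]
  have h0 : h 0 = u y := by simp [hh]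
  rw [← h1, ← h0, ← hftc, intervalIntegral.integral_of_le zero_le_one]
  rcases eq_or_ne z y with rfl | hzy
  · have : h = fun _ => u z := by funext t; simp [hh]
    simp [this]
  have hzy' : ‖z - y‖ₑ ≠ 0 := by simpa [sub_eq_zero] using hzy
  refine (enorm_integral_le_lintegral_enorm _).trans ?_
  rw [← lintegral_const_mul' _ _ enorm_ne_top]
  refine lintegral_mono fun t => ?_
  unfold extGradNorm
  split_ifs with hd
  · have : HasDerivAt h (fderiv ℝ u (y + t • (z - y)) (z - y)) t := by
      have hl : HasDerivAt (fun t : ℝ => y + t • (z - y)) (z - y) t := by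
        simpa using ((hasDerivAt_id t).smul_const (z - y)).const_add y
      exact hd.hasFDerivAt.comp_hasDerivAt t hl
    rw [this.deriv, mul_comm]
    exact ContinuousLinearMap.le_opENorm _ _
  · simp [ENNReal.mul_top hzy']

variable [FiniteDimensional ℝ E] [MeasurableSpace E] [BorelSpace E]

omit [FiniteDimensional ℝ E] in
lemma measurable_extGradNorm (u : E → ℝ) : Measurable (extGradNorm u) :=
  Measurable.ite (measurableSet_of_differentiableAt ℝ u) (measurable_fderiv ℝ u).enorm
    measurable_const

lemma LipschitzWith.extGradNorm_ae_eq {L : ℝ≥0} {u : E → ℝ} (hu : LipschitzWith L u)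
    (μ : Measure E) [μ.IsAddHaarMeasure] :
    extGradNorm u =ᵐ[μ] fun x => ‖fderiv ℝ u x‖ₑ := by
  filter_upwards [hu.ae_differentiableAt (μ := μ)] with x hx
  simp [extGradNorm, hx]

lemma lintegral_comp_add_smul (μ : Measure E) [μ.IsAddHaarMeasure] (a : E) {t : ℝ} (ht : t ≠ 0)
    {f : E → ℝ≥0∞} (hf : Measurable f) :
    ∫⁻ z, f (a + t • z) ∂μ =
      ENNReal.ofReal |(t ^ Module.finrank ℝ E)⁻¹| * ∫⁻ z, f z ∂μ := by
  have h1 : ∫⁻ z, f (a + t • z) ∂μ = ∫⁻ z, f (a + z) ∂(μ.map (t • ·)) := by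
    rw [lintegral_map (by fun_prop) (by fun_prop)]
  rw [h1, Measure.map_addHaar_smul μ ht, lintegral_smul_measure, lintegral_add_left_eq_self,
    smul_eq_mul]

lemma Convex.lintegral_lintegral_segment_le (μ : Measure E) [μ.IsAddHaarMeasure] {B : Set E}
    (hB : Convex ℝ B) (hBm : MeasurableSet B) {f : E → ℝ≥0∞} (hf : Measurable f) {t : ℝ}
    (ht : t ∈ Ioc (0 : ℝ) 1) :
    ∫⁻ y in B, ∫⁻ z in B, f (y + t • (z - y)) ∂μ ∂μ ≤
      2 ^ Module.finrank ℝ E * μ B * ∫⁻ x in B, f x ∂μ := by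
  have key : ∀ s : ℝ, s ∈ Icc (2⁻¹ : ℝ) 1 → ∀ y ∈ B,
      ∫⁻ z in B, f ((1 - s) • y + s • z) ∂μ ≤
        2 ^ Module.finrank ℝ E * ∫⁻ x in B, f x ∂μ := by
    intro s hs y hy
    have hs0 : 0 < s := lt_of_lt_of_le (by norm_num) hs.1
    calc ∫⁻ z in B, f ((1 - s) • y + s • z) ∂μ
        = ∫⁻ z in B, B.indicator f ((1 - s) • y + s • z) ∂μ := by
          refine setLIntegral_congr_fun hBm fun z hz => ?_
          rw [indicator_of_mem]
          exact hB hy hz (by linarith [hs.2]) hs0.le (by ring)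
      _ ≤ ∫⁻ z, B.indicator f ((1 - s) • y + s • z) ∂μ := setLIntegral_le_lintegral _ _
      _ = ENNReal.ofReal |(s ^ Module.finrank ℝ E)⁻¹| * ∫⁻ x in B, f x ∂μ := by
          rw [lintegral_comp_add_smul μ _ hs0.ne' (hf.indicator hBm), lintegral_indicator hBm]
      _ ≤ _ := by
          gcongr
          rw [← ENNReal.ofReal_ofNat, ← ENNReal.ofReal_pow (by norm_num)]
          apply ENNReal.ofReal_le_ofReal
          rw [abs_of_nonneg (by positivity), ← inv_pow]
          gcongr
          rw [inv_le_comm₀ hs0 (by norm_num)]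
          exact hs.1
  have aux : ∀ s : ℝ, s ∈ Icc (2⁻¹ : ℝ) 1 →
      ∫⁻ y in B, ∫⁻ z in B, f ((1 - s) • y + s • z) ∂μ ∂μ ≤
        2 ^ Module.finrank ℝ E * μ B * ∫⁻ x in B, f x ∂μ := by
    intro s hs
    calc _ ≤ ∫⁻ y in B, 2 ^ Module.finrank ℝ E * ∫⁻ x in B, f x ∂μ ∂μ :=
          setLIntegral_mono measurable_const (key s hs)
      _ = _ := by
          rw [setLIntegral_const]; ring
  rcases le_total 2⁻¹ t with h | h
  · refine le_trans (le_of_eq ?_) (aux t ⟨h, ht.2⟩)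
    congr! 5 with y z
    module
  · refine le_trans (le_of_eq ?_) (aux (1 - t) ⟨by linarith, by linarith [ht.1]⟩)
    rw [lintegral_lintegral_swap (by fun_prop)]
    congr! 5 with y z
    module

lemma ENNReal.rpow_lintegral_le_lintegral_rpow {α : Type*} [MeasurableSpace α] {ν : Measure α}
    [IsProbabilityMeasure ν] {f : α → ℝ≥0∞} (hf : AEMeasurable f ν) {p : ℝ} (hp : 1 ≤ p) :
    (∫⁻ a, f a ∂ν) ^ p ≤ ∫⁻ a, f a ^ p ∂ν := by
  have hp0 : 0 < p := by linarith
  have h := ENNReal.lintegral_mul_norm_pow_le (μ := ν) (f := fun a => f a ^ p) (g := fun _ => 1)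
    (hf.pow_const p) aemeasurable_const (p := p⁻¹) (q := 1 - p⁻¹) (by positivity)
    (by rw [sub_nonneg]; exact inv_le_one_of_one_le₀ hp) (by ring)
  simp only [ENNReal.one_rpow, mul_one, lintegral_const, measure_univ, ← ENNReal.rpow_mul,
    mul_inv_cancel₀ hp0.ne', ENNReal.rpow_one] at h
  calc _ ≤ ((∫⁻ a, f a ^ p ∂ν) ^ p⁻¹) ^ p := by gcongr
    _ = _ := by rw [← ENNReal.rpow_mul, inv_mul_cancel₀ hp0.ne', ENNReal.rpow_one]

/-- A two-point form of the Poincaré inequality on bounded convex sets. -/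
theorem LipschitzWith.lintegral_lintegral_enorm_sub_rpow_le (μ : Measure E) [μ.IsAddHaarMeasure]
    {L : ℝ≥0} {u : E → ℝ} (hu : LipschitzWith L u) {B : Set E} (hB : Convex ℝ B)
    (hBm : MeasurableSet B) {d : ℝ≥0∞} (hd : ∀ y ∈ B, ∀ z ∈ B, ‖z - y‖ₑ ≤ d) {p : ℝ}
    (hp : 1 ≤ p) :
    ∫⁻ y in B, ∫⁻ z in B, ‖u z - u y‖ₑ ^ p ∂μ ∂μ ≤
      d ^ p * (2 ^ Module.finrank ℝ E * μ B * ∫⁻ x in B, ‖fderiv ℝ u x‖ₑ ^ p ∂μ) := by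
  have hp0 : 0 ≤ p := by linarith
  have hg := measurable_extGradNorm u
  have hprob : IsProbabilityMeasure (volume.restrict (Ioc (0 : ℝ) 1)) := ⟨by simp⟩
  have hgp : Measurable fun x => extGradNorm u x ^ p := hg.pow_const p
  calc ∫⁻ y in B, ∫⁻ z in B, ‖u z - u y‖ₑ ^ p ∂μ ∂μ
      ≤ ∫⁻ y in B, ∫⁻ z in B, d ^ p *
          (∫⁻ t in Ioc (0 : ℝ) 1, extGradNorm u (y + t • (z - y)) ^ p) ∂μ ∂μ := by
        refine setLIntegral_mono' hBm fun y hy => setLIntegral_mono' hBm fun z hz => ?_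
        calc ‖u z - u y‖ₑ ^ p
            ≤ (‖z - y‖ₑ * ∫⁻ t in Ioc (0 : ℝ) 1, extGradNorm u (y + t • (z - y))) ^ p := by
              gcongr; exact hu.enorm_sub_le_lintegral y z
          _ ≤ _ := by
              rw [ENNReal.mul_rpow_of_nonneg _ _ hp0]
              gcongr
              · exact hd y hy z hz
              · exact ENNReal.rpow_lintegral_le_lintegral_rpow (by fun_prop) hp
    _ = d ^ p * ∫⁻ t in Ioc (0 : ℝ) 1, (∫⁻ y in B, ∫⁻ z in B,
          extGradNorm u (y + t • (z - y)) ^ p ∂μ ∂μ) := by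
        have h3 : Measurable fun q : (E × E) × ℝ =>
            extGradNorm u (q.1.1 + q.2 • (q.1.2 - q.1.1)) ^ p := by fun_prop
        have h2 : Measurable fun q : E × E =>
            ∫⁻ t in Ioc (0 : ℝ) 1, extGradNorm u (q.1 + t • (q.2 - q.1)) ^ p :=
          h3.lintegral_prod_right'
        have h4 : Measurable fun q : (E × ℝ) × E =>
            extGradNorm u (q.1.1 + q.1.2 • (q.2 - q.1.1)) ^ p := by fun_prop
        have h5 : Measurable fun q : E × ℝ => ∫⁻ z in B,
            extGradNorm u (q.1 + q.2 • (z - q.1)) ^ p ∂μ := h4.lintegral_prod_right'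
        have e : ∀ y, ∫⁻ z in B, d ^ p *
            (∫⁻ t in Ioc (0 : ℝ) 1, extGradNorm u (y + t • (z - y)) ^ p) ∂μ =
            d ^ p * ∫⁻ t in Ioc (0 : ℝ) 1, (∫⁻ z in B,
              extGradNorm u (y + t • (z - y)) ^ p ∂μ) := fun y => by
          rw [lintegral_const_mul _ (by fun_prop), lintegral_lintegral_swap (by fun_prop)]
        simp_rw [e]
        rw [lintegral_const_mul _ (by fun_prop), lintegral_lintegral_swap (by fun_prop)]
    _ ≤ d ^ p * ∫⁻ _ in Ioc (0 : ℝ) 1,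
          (2 ^ Module.finrank ℝ E * μ B * ∫⁻ x in B, extGradNorm u x ^ p ∂μ) := by
        refine mul_le_mul_right ?_ _
        exact setLIntegral_mono' measurableSet_Ioc fun t ht =>
          hB.lintegral_lintegral_segment_le μ hBm hgp ht
    _ = _ := by
        rw [lintegral_const, measure_univ, mul_one]
        congr 2
        refine lintegral_congr_ae (ae_restrict_of_ae ?_)
        filter_upwards [hu.extGradNorm_ae_eq μ] with x hx
        rw [hx]

end Poincare

lemma LipschitzWith.mul_of_bound {α : Type*} [PseudoMetricSpace α] {f g : α → ℝ} {K L : ℝ≥0}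
    (hf : LipschitzWith K f) (hg : LipschitzWith L g) {A B : ℝ≥0} (hA : ∀ x, |f x| ≤ A)
    (hB : ∀ x, |g x| ≤ B) : LipschitzWith (A * L + B * K) fun x => f x * g x := by
  refine LipschitzWith.of_dist_le_mul fun x y => ?_
  have h1 := hf.dist_le_mul x y
  have h2 := hg.dist_le_mul x y
  rw [Real.dist_eq] at *
  push_cast
  calc |f x * g x - f y * g y| = |f x * (g x - g y) + g y * (f x - f y)| := by ring_nf
    _ ≤ |f x| * |g x - g y| + |g y| * |f x - f y| := by
        rw [← abs_mul, ← abs_mul]; exact abs_add_le _ _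
    _ ≤ A * (L * dist x y) + B * (K * dist x y) := by
        gcongr
        · exact hA x
        · exact hB y
    _ = _ := by ring

/-- A Lipschitz cutoff, equal to `1` on `closedBall x r` and to `0` off `ball x (3 * r / 2)`. -/
noncomputable def ballCutoff {α : Type*} [PseudoMetricSpace α] (x : α) (r : ℝ) (y : α) : ℝ :=
  max 0 (min 1 (3 - 2 / r * dist y x))

section ballCutoff

variable {α : Type*} [PseudoMetricSpace α] (x : α) {r : ℝ}

lemma lipschitzWith_ballCutoff (hr : 0 < r) :
    LipschitzWith (2 / r).toNNReal (ballCutoff x r) := by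
  refine LipschitzWith.const_max (LipschitzWith.const_min ?_ _) _
  refine LipschitzWith.of_dist_le_mul fun y z => ?_
  rw [Real.coe_toNNReal _ (by positivity), Real.dist_eq]
  calc |3 - 2 / r * dist y x - (3 - 2 / r * dist z x)| = |2 / r * (dist z x - dist y x)| := by
        ring_nf
    _ = 2 / r * |dist z x - dist y x| := by rw [abs_mul, abs_of_pos (by positivity : 0 < 2 / r)]
    _ ≤ 2 / r * dist y z := by
        gcongr
        rw [dist_comm y z]
        exact abs_dist_sub_le z y x

lemma ballCutoff_nonneg (r : ℝ) (y : α) : 0 ≤ ballCutoff x r y := le_max_left _ _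

lemma ballCutoff_le_one (r : ℝ) (y : α) : ballCutoff x r y ≤ 1 :=
  max_le zero_le_one (min_le_left _ _)

lemma abs_ballCutoff_le_one (r : ℝ) (y : α) : |ballCutoff x r y| ≤ 1 := by
  rw [abs_of_nonneg (ballCutoff_nonneg x r y)]; exact ballCutoff_le_one x r y

variable {x}

lemma ballCutoff_eq_one (hr : 0 < r) {y : α} (hy : y ∈ closedBall x r) :
    ballCutoff x r y = 1 := by
  have : 2 / r * dist y x ≤ 2 := by
    rw [div_mul_eq_mul_div, div_le_iff₀ hr]
    exact mul_le_mul_of_nonneg_left hy two_pos.le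
  rw [ballCutoff, min_eq_left (by linarith), max_eq_right zero_le_one]

variable (x) in
lemma tsupport_ballCutoff_subset (hr : 0 < r) :
    tsupport (ballCutoff x r) ⊆ closedBall x (3 / 2 * r) := by
  refine closure_minimal (fun y hy => ?_) isClosed_closedBall
  by_contra h
  rw [mem_closedBall, not_le] at h
  apply hy
  have : 3 ≤ 2 / r * dist y x := by
    rw [div_mul_eq_mul_div, le_div_iff₀ hr]; linarith
  exact max_eq_left ((min_le_right _ _).trans (by linarith))

end ballCutoff

section Lintegral

variable {E : Type*} [NormedAddCommGroup E] [NormedSpace ℝ E] [FiniteDimensional ℝ E]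
  [MeasurableSpace E] [BorelSpace E] (μ : Measure E)

omit [FiniteDimensional ℝ E] [MeasurableSpace E] [BorelSpace E] in
lemma LipschitzWith.enorm_fderiv_le {L : ℝ≥0} {u : E → ℝ} (hu : LipschitzWith L u) (x : E) :
    ‖fderiv ℝ u x‖ₑ ≤ L := by
  exact_mod_cast norm_fderiv_le_of_lipschitz ℝ hu

omit [FiniteDimensional ℝ E] in
lemma LipschitzWith.ofReal_integral_norm_fderiv_rpow {L : ℝ≥0} {u : E → ℝ}
    (hu : LipschitzWith L u) {U : Set E} (hU : μ U ≠ ∞) {p : ℝ} (hp : 0 ≤ p) :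
    ENNReal.ofReal (∫ x in U, ‖fderiv ℝ u x‖ ^ p ∂μ) = ∫⁻ x in U, ‖fderiv ℝ u x‖ₑ ^ p ∂μ := by
  rw [ofReal_integral_eq_lintegral_ofReal]
  · refine lintegral_congr fun x => ?_
    rw [← ENNReal.ofReal_rpow_of_nonneg (norm_nonneg _) hp, ofReal_norm]
  · refine Integrable.mono' (g := fun _ => (L : ℝ) ^ p) (integrableOn_const hU)
      ((measurable_fderiv ℝ u).norm.pow_const p).aestronglyMeasurable (ae_of_all _ fun x => ?_)
    rw [Real.norm_of_nonneg (by positivity)]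
    gcongr
    exact norm_fderiv_le_of_lipschitz ℝ hu
  · exact ae_of_all _ fun x => by positivity

omit [FiniteDimensional ℝ E] [BorelSpace E] in
lemma setLIntegral_enorm_fderiv_rpow_of_tsupport_subset {u : E → ℝ} {U : Set E}
    (hU : tsupport u ⊆ U) {p : ℝ} (hp : 0 < p) :
    ∫⁻ x in U, ‖fderiv ℝ u x‖ₑ ^ p ∂μ = ∫⁻ x, ‖fderiv ℝ u x‖ₑ ^ p ∂μ := by
  refine setLIntegral_eq_of_support_subset fun x hx => hU (support_fderiv_subset ℝ ?_)
  intro h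
  have h' : ‖fderiv ℝ u x‖ₑ = 0 := by rw [← ofReal_norm, h, norm_zero, ENNReal.ofReal_zero]
  exact hx (by simp only [h', ENNReal.zero_rpow_of_pos hp])

variable [μ.IsAddHaarMeasure]

/-- The Poincaré inequality for Lipschitz functions vanishing off a ball. -/
lemma LipschitzWith.lintegral_enorm_rpow_le_of_eq_zero_off_ball [Nontrivial E] {L : ℝ≥0}
    {u : E → ℝ} (hu : LipschitzWith L u) {x : E} {R : ℝ} (hR : 0 < R)
    (h0 : ∀ y ∉ ball x R, u y = 0) {p : ℝ} (hp : 1 ≤ p) :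
    ∫⁻ y, ‖u y‖ₑ ^ p ∂μ ≤
      ENNReal.ofReal (6 * R) ^ p * (6 ^ Module.finrank ℝ E * ∫⁻ y, ‖fderiv ℝ u y‖ₑ ^ p ∂μ) := by
  have hp0 : 0 < p := by linarith
  obtain ⟨e, he⟩ := exists_norm_eq E (by positivity : 0 ≤ 2 * R)
  set V := μ (ball (0 : E) R) with hV
  have hV0 : V ≠ 0 := (measure_ball_pos μ _ hR).ne'
  have hVtop : V ≠ ∞ := measure_ball_lt_top.ne
  have hV3 : μ (ball x (3 * R)) = 3 ^ Module.finrank ℝ E * V := by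
    rw [Measure.addHaar_ball_mul_of_pos μ x (by norm_num), ENNReal.ofReal_pow (by norm_num)]
    simp [hV]
  have hsub : ball (x + e) R ⊆ ball x (3 * R) := by
    apply ball_subset_ball'
    simp [he]; linarith
  have hzero : ∀ z ∈ ball (x + e) R, u z = 0 := fun z hz => h0 z fun hz' => by
    have h1 : dist (x + e) x ≤ dist (x + e) z + dist z x := dist_triangle _ _ _
    rw [mem_ball] at hz hz'
    rw [dist_comm] at hz
    simp [he] at h1
    linarith
  have hsup : ∫⁻ y, ‖u y‖ₑ ^ p ∂μ = ∫⁻ y in ball x (3 * R), ‖u y‖ₑ ^ p ∂μ := by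
    refine (setLIntegral_eq_of_support_subset fun y hy => ?_).symm
    by_contra h
    have h' : y ∉ ball x R := fun h' => h (ball_subset_ball (by linarith) h')
    simp [h0 y h', hp0] at hy
  have key := hu.lintegral_lintegral_enorm_sub_rpow_le μ (convex_ball x (3 * R))
    measurableSet_ball (d := ENNReal.ofReal (6 * R)) (fun y hy z hz => by
      rw [← ofReal_norm, ← dist_eq_norm]
      apply ENNReal.ofReal_le_ofReal
      have := dist_triangle_right z y x
      rw [mem_ball] at hy hz
      linarith) hp
  have low : V * ∫⁻ y, ‖u y‖ₑ ^ p ∂μ ≤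
      ∫⁻ y in ball x (3 * R), ∫⁻ z in ball x (3 * R), ‖u z - u y‖ₑ ^ p ∂μ ∂μ := by
    calc V * ∫⁻ y, ‖u y‖ₑ ^ p ∂μ = ∫⁻ y in ball (x + e) R, ∫⁻ z in ball x (3 * R),
          ‖u z - u y‖ₑ ^ p ∂μ ∂μ := by
          rw [setLIntegral_congr_fun (g := fun _ => ∫⁻ z, ‖u z‖ₑ ^ p ∂μ) measurableSet_ball
            (fun y hy => by simp only [hzero y hy, sub_zero, hsup]), setLIntegral_const, hV,
            Measure.addHaar_ball_center μ (x + e), mul_comm]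
      _ ≤ _ := lintegral_mono_set hsub
  have := low.trans key
  rw [hV3] at this
  refine (ENNReal.mul_le_mul_iff_right hV0 hVtop).1 (this.trans ?_)
  calc _ ≤ ENNReal.ofReal (6 * R) ^ p * (2 ^ Module.finrank ℝ E *
        (3 ^ Module.finrank ℝ E * V) * ∫⁻ y, ‖fderiv ℝ u y‖ₑ ^ p ∂μ) := by
        gcongr; exact Measure.restrict_le_self
    _ = _ := by
        rw [show (6 : ℝ≥0∞) = 2 * 3 by norm_num, mul_pow]; ring

end Lintegral

section Capacity

variable {n : ℕ} {p : ℝ}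

lemma pCap_ball_lower_bound (hn : 0 < n) (hp : 1 ≤ p) (x : EuclideanSpace ℝ (Fin n)) {r : ℝ}
    (hr : 0 < r) :
    volume (ball x r) ≤ ENNReal.ofReal (12 * r) ^ p * 6 ^ n *
      ENNReal.ofReal (pCap n p (closedBall x r) (ball x (2 * r))) := by
  have hp0 : 0 < p := by linarith
  have : Nonempty (Fin n) := ⟨⟨0, hn⟩⟩
  set K : ℝ := (12 * r) ^ p * 6 ^ n with hK
  have hKpos : 0 < K := by positivity
  have hKe : ENNReal.ofReal (12 * r) ^ p * 6 ^ n = ENNReal.ofReal K := by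
    rw [hK, ENNReal.ofReal_mul (p := (12 * r) ^ p) (by positivity),
      ENNReal.ofReal_pow (by norm_num), ENNReal.ofReal_rpow_of_pos (by positivity),
      ENNReal.ofReal_ofNat]
  rw [hKe, ← ENNReal.ofReal_mul hKpos.le]
  apply ENNReal.le_ofReal_iff_toReal_le measure_ball_lt_top.ne _ |>.2 _
  · refine mul_nonneg hKpos.le (Real.sInf_nonneg ?_)
    rintro c ⟨φ, -, -, -, -, rfl⟩
    positivity
  rw [← div_le_iff₀' hKpos]
  refine le_csInf ?_ ?_
  · refine ⟨_, ballCutoff x r, ⟨_, lipschitzWith_ballCutoff x hr⟩, ?_, ?_, fun y hy =>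
      (ballCutoff_eq_one hr hy).ge, rfl⟩
    · exact (isCompact_closedBall _ _).of_isClosed_subset (isClosed_tsupport _)
        (tsupport_ballCutoff_subset x hr)
    · exact (tsupport_ballCutoff_subset x hr).trans (closedBall_subset_ball (by linarith))
  · rintro c ⟨φ, ⟨L, hL⟩, -, hs, h1, rfl⟩
    rw [div_le_iff₀' hKpos]
    refine (ENNReal.le_ofReal_iff_toReal_le measure_ball_lt_top.ne (by positivity)).1 ?_
    rw [ENNReal.ofReal_mul hKpos.le, hL.ofReal_integral_norm_fderiv_rpow _
      measure_ball_lt_top.ne hp0.le, setLIntegral_enorm_fderiv_rpow_of_tsupport_subset _ hs hp0]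
    have hP := hL.lintegral_enorm_rpow_le_of_eq_zero_off_ball volume (x := x) (R := 2 * r)
      (by positivity) (fun y hy => image_eq_zero_of_notMem_tsupport fun h => hy (hs h)) hp
    rw [← mul_assoc, show 6 * (2 * r) = 12 * r by ring, finrank_euclideanSpace_fin, hKe] at hP
    refine le_trans ?_ hP
    calc volume (ball x r) = ∫⁻ y in ball x r, 1 := by simp
      _ ≤ ∫⁻ y in ball x r, ‖φ y‖ₑ ^ p := by
          refine setLIntegral_mono' measurableSet_ball fun y hy => ?_
          refine ENNReal.one_le_rpow ?_ hp0
          rw [← ofReal_norm, ← ENNReal.ofReal_one]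
          exact ENNReal.ofReal_le_ofReal ((h1 y (ball_subset_closedBall hy)).trans (le_abs_self _))
      _ ≤ _ := setLIntegral_le_lintegral _ _

lemma UniformlyFat.volume_ball_le {c₀ r₀ : ℝ} {F : Set (EuclideanSpace ℝ (Fin n))}
    (hF : UniformlyFat n p c₀ r₀ F) (hn : 0 < n) (hp : 1 ≤ p) (hc₀ : 0 < c₀)
    {x : EuclideanSpace ℝ (Fin n)} (hx : x ∈ frontier F) {r : ℝ} (hr : 0 < r) (hr₀ : r ≤ r₀)
    {L : ℝ≥0} {φ : EuclideanSpace ℝ (Fin n) → ℝ} (hL : LipschitzWith L φ)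
    (hφ : tsupport φ ⊆ closedBall x (3 / 2 * r)) (h1 : ∀ y ∈ F ∩ closedBall x r, 1 ≤ φ y) :
    ENNReal.ofReal c₀ * volume (ball x r) ≤
      ENNReal.ofReal (12 * r) ^ p * 6 ^ n * ∫⁻ y in ball x (2 * r), ‖fderiv ℝ φ y‖ₑ ^ p := by
  have hp0 : 0 < p := by linarith
  calc _ ≤ ENNReal.ofReal c₀ * (ENNReal.ofReal (12 * r) ^ p * 6 ^ n *
      ENNReal.ofReal (pCap n p (closedBall x r) (ball x (2 * r)))) := by
        gcongr; exact pCap_ball_lower_bound hn hp x hr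
    _ = ENNReal.ofReal (12 * r) ^ p * 6 ^ n *
      ENNReal.ofReal (c₀ * pCap n p (closedBall x r) (ball x (2 * r))) := by
        rw [ENNReal.ofReal_mul hc₀.le]; ring
    _ ≤ _ := by
        gcongr
        rw [← hL.ofReal_integral_norm_fderiv_rpow _ measure_ball_lt_top.ne hp0.le]
        refine ENNReal.ofReal_le_ofReal ((hF x hx r hr hr₀).trans (csInf_le ⟨0, ?_⟩ ?_))
        · rintro c ⟨φ, -, -, -, -, rfl⟩
          positivity
        · exact ⟨φ, ⟨L, hL⟩, (isCompact_closedBall _ _).of_isClosed_subset (isClosed_tsupport _) hφ,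
            hφ.trans (closedBall_subset_ball (by linarith)), h1, rfl⟩

end Capacity

section Mazya

variable {n : ℕ} {p : ℝ}

/-- The derivative of a cutoff of `1 - u / u z`, rescaled by `u z`. -/
lemma enorm_mul_enorm_fderiv_cutoff_le {E : Type*} [NormedAddCommGroup E] [NormedSpace ℝ E]
    {u η : E → ℝ} {K : ℝ≥0} (hηL : LipschitzWith K η) (hη : ∀ y, |η y| ≤ 1) {c : ℝ}
    (hc : c ≠ 0) {y : E} (hu : DifferentiableAt ℝ u y) (hηd : DifferentiableAt ℝ η y) :
    ‖c‖ₑ * ‖fderiv ℝ (fun y => η y * (1 - u y / c)) y‖ₑ ≤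
      ‖fderiv ℝ u y‖ₑ + K * ‖c - u y‖ₑ := by
  have hd : HasFDerivAt (fun y => η y * (1 - u y / c))
      (η y • (-(c⁻¹ • fderiv ℝ u y)) + (1 - u y / c) • fderiv ℝ η y) y := by
    have h1 : HasFDerivAt (fun y => 1 - u y / c) (-(c⁻¹ • fderiv ℝ u y)) y := by
      simp only [div_eq_mul_inv]
      exact (hu.hasFDerivAt.mul_const c⁻¹).const_sub 1
    exact hηd.hasFDerivAt.mul h1
  rw [← enorm_smul, hd.fderiv]
  have e : c • (η y • (-(c⁻¹ • fderiv ℝ u y)) + (1 - u y / c) • fderiv ℝ η y) =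
      -(η y • fderiv ℝ u y) + (c - u y) • fderiv ℝ η y := by
    rw [smul_add, smul_smul, smul_neg, smul_smul, smul_smul]
    congr 3
    · field_simp
    · field_simp
  rw [e]
  refine (enorm_add_le (E := E →L[ℝ] ℝ) _ _).trans ?_
  rw [enorm_neg, enorm_smul, enorm_smul, mul_comm ‖c - u y‖ₑ]
  gcongr
  · refine mul_le_of_le_one_left' ?_
    rw [← ofReal_norm, ← ENNReal.ofReal_one]
    exact ENNReal.ofReal_le_ofReal (hη y)
  · exact hηL.enorm_fderiv_le y

/-- The Maz'ya-type inequality on balls centred at boundary points of a `p`-fat set. -/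
theorem UniformlyFat.exists_lintegral_ball_le {c₀ r₀ : ℝ} {F : Set (EuclideanSpace ℝ (Fin n))}
    (hF : UniformlyFat n p c₀ r₀ F) (hn : 0 < n) (hp : 1 ≤ p) (hc₀ : 0 < c₀) :
    ∃ A : ℝ≥0, ∀ x ∈ frontier F, ∀ r : ℝ, 0 < r → r ≤ r₀ →
      ∀ (L : ℝ≥0) (u : EuclideanSpace ℝ (Fin n) → ℝ), LipschitzWith L u → HasCompactSupport u →
      (∀ y ∈ F, u y = 0) →
      ∫⁻ y in ball x (2 * r), ‖u y‖ₑ ^ p ≤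
        A * ENNReal.ofReal r ^ p * ∫⁻ y in ball x (2 * r), ‖fderiv ℝ u y‖ₑ ^ p := by
  have hp0 : 0 < p := by linarith
  have hn' : Nonempty (Fin n) := ⟨⟨0, hn⟩⟩
  set A₀ : ℝ≥0∞ := (ENNReal.ofReal c₀)⁻¹ *
    (ENNReal.ofReal 12 ^ p * 6 ^ n * 2 ^ (p - 1) * 2 ^ n * (1 + 8 ^ p * 2 ^ n)) with hA₀
  have hA₀top : A₀ ≠ ∞ := by
    refine ENNReal.mul_ne_top (by simpa using hc₀) ?_
    have h1 : ENNReal.ofReal 12 ^ p ≠ ∞ := ENNReal.rpow_ne_top_of_nonneg hp0.le (by simp)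
    have h2 : (2 : ℝ≥0∞) ^ (p - 1) ≠ ∞ := ENNReal.rpow_ne_top_of_nonneg (by linarith) (by simp)
    have h3 : (8 : ℝ≥0∞) ^ p ≠ ∞ := ENNReal.rpow_ne_top_of_nonneg hp0.le (by simp)
    finiteness
  refine ⟨A₀.toNNReal, fun x hx r hr hr₀ L u hu hsupp h0 => ?_⟩
  rw [ENNReal.coe_toNNReal hA₀top]
  set B := ball x (2 * r) with hB
  set V := volume (ball x r) with hV
  have hV0 : V ≠ 0 := (measure_ball_pos _ _ hr).ne'
  have hVtop : V ≠ ∞ := measure_ball_lt_top.ne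
  have hVB : volume B = 2 ^ n * V := by
    rw [hB, Measure.addHaar_ball_mul_of_pos volume x (by norm_num), hV,
      Measure.addHaar_ball_center volume x r, finrank_euclideanSpace_fin,
      ENNReal.ofReal_pow (by norm_num), ENNReal.ofReal_ofNat]
  set G := ∫⁻ y in B, ‖fderiv ℝ u y‖ₑ ^ p with hG
  set K := ENNReal.ofReal (12 * r) ^ p * 6 ^ n with hK
  have hKtop : K ≠ ∞ := by
    have h1 : ENNReal.ofReal (12 * r) ^ p ≠ ∞ :=
      ENNReal.rpow_ne_top_of_nonneg hp0.le ENNReal.ofReal_ne_top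
    finiteness
  set s : ℝ≥0 := (2 / r).toNNReal with hs
  obtain ⟨M, hM⟩ := hsupp.exists_bound_of_continuous hu.continuous
  have pointwise : ∀ z, ‖u z‖ₑ ^ p * (ENNReal.ofReal c₀ * V) ≤
      K * (2 ^ (p - 1) * (G + s ^ p * ∫⁻ y in B, ‖u y - u z‖ₑ ^ p)) := by
    intro z
    rcases eq_or_ne (u z) 0 with hz | hz
    · simp [hz, hp0]
    have hηL := lipschitzWith_ballCutoff x hr
    have hwL : LipschitzWith (‖(u z)⁻¹‖₊ * L) fun y => 1 - u y / u z := by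
      refine LipschitzWith.of_dist_le_mul fun y y' => ?_
      rw [Real.dist_eq]
      calc |1 - u y / u z - (1 - u y' / u z)| = |(u z)⁻¹| * |u y' - u y| := by
            rw [← abs_mul]; ring_nf
        _ ≤ |(u z)⁻¹| * (L * dist y y') := by
            gcongr
            rw [dist_comm]
            exact hu.dist_le_mul y' y
        _ = _ := by push_cast; rw [Real.norm_eq_abs]; ring
    have hwB : ∀ y, |1 - u y / u z| ≤ (1 + M.toNNReal * ‖(u z)⁻¹‖₊ : ℝ≥0) := by
      intro y
      push_cast
      rw [Real.norm_eq_abs]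
      calc |1 - u y / u z| ≤ |1| + |u y / u z| := abs_sub _ _
        _ = 1 + |u y| * |(u z)⁻¹| := by rw [abs_one, div_eq_mul_inv, abs_mul]
        _ ≤ _ := by
          gcongr
          exact (hM y).trans (Real.le_coe_toNNReal M)
    have hψL := hηL.mul_of_bound hwL (A := 1) (fun y => abs_ballCutoff_le_one x r y) hwB
    have hcap := hF.volume_ball_le hn hp hc₀ hx hr hr₀ hψL
      ((tsupport_mul_subset_left (f := ballCutoff x r)).trans (tsupport_ballCutoff_subset x hr))
      (fun y hy => by
        rw [ballCutoff_eq_one hr hy.2, h0 y hy.1]; simp)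
    calc _ ≤ ‖u z‖ₑ ^ p * (K * ∫⁻ y in B,
          ‖fderiv ℝ (fun y => ballCutoff x r y * (1 - u y / u z)) y‖ₑ ^ p) := by gcongr
      _ = K * ∫⁻ y in B,
          (‖u z‖ₑ * ‖fderiv ℝ (fun y => ballCutoff x r y * (1 - u y / u z)) y‖ₑ) ^ p := by
          simp_rw [ENNReal.mul_rpow_of_nonneg _ _ hp0.le]
          rw [lintegral_const_mul' _ _ (ENNReal.rpow_ne_top_of_nonneg hp0.le enorm_ne_top)]
          ring
      _ ≤ K * ∫⁻ y in B,
          2 ^ (p - 1) * (‖fderiv ℝ u y‖ₑ ^ p + s ^ p * ‖u y - u z‖ₑ ^ p) := by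
          refine mul_le_mul_right ?_ _
          refine lintegral_mono_ae (ae_restrict_of_ae ?_)
          filter_upwards [hu.ae_differentiableAt, hηL.ae_differentiableAt] with y hy1 hy2
          rw [← ENNReal.mul_rpow_of_nonneg _ _ hp0.le]
          refine le_trans ?_ (ENNReal.rpow_add_le_mul_rpow_add_rpow _ _ hp)
          gcongr
          rw [enorm_sub_rev]
          exact enorm_mul_enorm_fderiv_cutoff_le hηL (abs_ballCutoff_le_one x r) hz hy1 hy2
      _ = _ := by
          have := hu.continuous.measurable
          rw [lintegral_const_mul _ (by fun_prop), lintegral_add_left (by fun_prop),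
            lintegral_const_mul _ (by fun_prop)]
  have poin := hu.lintegral_lintegral_enorm_sub_rpow_le volume (convex_ball x (2 * r))
    measurableSet_ball (d := ENNReal.ofReal (4 * r)) (fun y hy z hz => by
      rw [← ofReal_norm, ← dist_eq_norm]
      apply ENNReal.ofReal_le_ofReal
      have := dist_triangle_right z y x
      rw [mem_ball] at hy hz
      linarith) hp
  rw [← hB, hVB, finrank_euclideanSpace_fin, ← hG] at poin
  have total : (∫⁻ z in B, ‖u z‖ₑ ^ p) * (ENNReal.ofReal c₀ * V) ≤
      K * (2 ^ (p - 1) * (2 ^ n * V * G +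
        s ^ p * (ENNReal.ofReal (4 * r) ^ p * (2 ^ n * (2 ^ n * V) * G)))) := by
    have hum := hu.continuous.measurable
    rw [← lintegral_mul_const _ (by fun_prop)]
    refine (lintegral_mono pointwise).trans ?_
    rw [lintegral_const_mul _ (by fun_prop), lintegral_const_mul _ (by fun_prop),
      lintegral_add_left (by fun_prop), lintegral_const_mul _ (by fun_prop), setLIntegral_const,
      hVB, mul_comm G]
    gcongr
  have hsr : (s : ℝ≥0∞) ^ p * ENNReal.ofReal (4 * r) ^ p = 8 ^ p := by
    rw [← ENNReal.mul_rpow_of_nonneg _ _ hp0.le, hs]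
    change (ENNReal.ofReal (2 / r) * ENNReal.ofReal (4 * r)) ^ p = 8 ^ p
    rw [← ENNReal.ofReal_mul (by positivity), show 2 / r * (4 * r) = 8 by field_simp; norm_num,
      ENNReal.ofReal_ofNat]
  have hc0 : ENNReal.ofReal c₀ ≠ 0 := by simpa using hc₀
  have hcV0 : ENNReal.ofReal c₀ * V ≠ 0 := mul_ne_zero hc0 hV0
  have hcVtop : ENNReal.ofReal c₀ * V ≠ ∞ := ENNReal.mul_ne_top ENNReal.ofReal_ne_top hVtop
  rw [← ENNReal.mul_le_mul_iff_left hcV0 hcVtop]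
  refine total.trans (le_of_eq ?_)
  have hK' : K = ENNReal.ofReal 12 ^ p * ENNReal.ofReal r ^ p * 6 ^ n := by
    rw [hK, ENNReal.ofReal_mul (by norm_num), ENNReal.mul_rpow_of_nonneg _ _ hp0.le]
  calc _ = K * (2 ^ (p - 1) * (2 ^ n * V * G + (s ^ p * ENNReal.ofReal (4 * r) ^ p) *
        (2 ^ n * (2 ^ n * V) * G))) := by ring
    _ = ((ENNReal.ofReal c₀)⁻¹ * ENNReal.ofReal c₀) * (K * (2 ^ (p - 1) * (2 ^ n * V * G +
        8 ^ p * (2 ^ n * (2 ^ n * V) * G)))) := by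
        rw [hsr, ENNReal.inv_mul_cancel hc0 ENNReal.ofReal_ne_top, one_mul]
    _ = _ := by rw [hA₀, hK']; ring

end Mazya

section Averaging

variable {E : Type*} [NormedAddCommGroup E] [NormedSpace ℝ E] [FiniteDimensional ℝ E]
  [MeasurableSpace E] [BorelSpace E] (μ : Measure E) [μ.IsAddHaarMeasure]

lemma measurable_indicator_ball {f : E → ℝ≥0∞} (hf : Measurable f) (r : ℝ) :
    Measurable fun q : E × E => (ball q.1 r).indicator f q.2 := by
  have hs : MeasurableSet {q : E × E | dist q.2 q.1 < r} :=
    measurableSet_lt (by fun_prop) measurable_const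
  have : (fun q : E × E => (ball q.1 r).indicator f q.2) =
      {q : E × E | dist q.2 q.1 < r}.indicator fun q => f q.2 := by
    funext q
    by_cases h : dist q.2 q.1 < r <;> simp [indicator, h]
  rw [this]
  exact (hf.comp measurable_snd).indicator hs

/-- Averaging over centres: integral inequalities on all balls meeting a set give integral
inequalities on neighbourhoods of the set. -/
lemma lintegral_thickening_le_of_ball {S : Set E} {f g : E → ℝ≥0∞}
    (hf : Measurable f) (hg : Measurable g) {t : ℝ} (ht : 0 < t) {c : ℝ≥0∞} (hc : c ≠ ∞)
    (h : ∀ w, infDist w S < t → ∫⁻ y in ball w t, f y ∂μ ≤ c * ∫⁻ y in ball w (3 * t), g y ∂μ) :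
    ∫⁻ y in {y | infDist y S < t / 2}, f y ∂μ ≤
      c * 6 ^ Module.finrank ℝ E * ∫⁻ y in {y | infDist y S < 4 * t}, g y ∂μ := by
  have hN : ∀ r, MeasurableSet {y | infDist y S < r} := fun r =>
    measurableSet_lt measurable_infDist measurable_const
  set V := μ (ball (0 : E) (t / 2)) with hV
  have hV0 : V ≠ 0 := (measure_ball_pos μ _ (by positivity)).ne'
  have hVtop : V ≠ ∞ := measure_ball_lt_top.ne
  have hV6 : ∀ y, μ (ball y (3 * t)) = 6 ^ Module.finrank ℝ E * V := fun y => by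
    rw [show 3 * t = 6 * (t / 2) by ring, Measure.addHaar_ball_mul_of_pos μ y (by norm_num),
      ENNReal.ofReal_pow (by norm_num), ENNReal.ofReal_ofNat]
  have hfm := measurable_indicator_ball hf t
  have hgm := measurable_indicator_ball hg (3 * t)
  have lower : V * ∫⁻ y in {y | infDist y S < t / 2}, f y ∂μ ≤
      ∫⁻ y in {y | infDist y S < t / 2}, ∫⁻ w in {w | infDist w S < t},
        (ball w t).indicator f y ∂μ ∂μ := by
    rw [← lintegral_const_mul _ hf]
    refine setLIntegral_mono' (hN _) fun y hy => ?_
    calc V * f y = ∫⁻ w in ball y (t / 2), (ball w t).indicator f y ∂μ := by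
          rw [setLIntegral_congr_fun (g := fun _ => f y) measurableSet_ball fun w hw => ?_,
            setLIntegral_const, Measure.addHaar_ball_center μ y, mul_comm]
          refine indicator_of_mem ?_ _
          rw [mem_ball] at hw ⊢
          rw [dist_comm]
          linarith
      _ ≤ _ := by
          refine lintegral_mono_set fun w hw => ?_
          have := infDist_le_infDist_add_dist (s := S) (x := w) (y := y)
          rw [mem_ball] at hw
          rw [mem_ofPred_eq] at *
          linarith
  have upper : ∫⁻ w in {w | infDist w S < t}, ∫⁻ y, (ball w (3 * t)).indicator g y ∂μ ∂μ ≤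
      6 ^ Module.finrank ℝ E * V * ∫⁻ y in {y | infDist y S < 4 * t}, g y ∂μ := by
    rw [lintegral_lintegral_swap hgm.aemeasurable, ← lintegral_indicator (hN _),
      ← lintegral_const_mul _ (hg.indicator (hN _))]
    refine lintegral_mono fun y => ?_
    calc _ ≤ ∫⁻ w in {w | infDist w S < t}, (ball y (3 * t)).indicator
          (fun _ => {y | infDist y S < 4 * t}.indicator g y) w ∂μ := by
          refine setLIntegral_mono' (hN _) fun w hw => ?_
          by_cases hy : y ∈ ball w (3 * t)
          · rw [indicator_of_mem hy, indicator_of_mem (by rwa [mem_ball']), indicator_of_mem]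
            have := infDist_le_infDist_add_dist (s := S) (x := y) (y := w)
            rw [mem_ball] at hy
            rw [mem_ofPred_eq] at *
            linarith
          · simp [indicator_of_notMem hy]
      _ ≤ ∫⁻ w, (ball y (3 * t)).indicator
          (fun _ => {y | infDist y S < 4 * t}.indicator g y) w ∂μ := setLIntegral_le_lintegral _ _
      _ = _ := by
          rw [lintegral_indicator measurableSet_ball, setLIntegral_const, hV6, mul_comm]
  refine (ENNReal.mul_le_mul_iff_right hV0 hVtop).1 (lower.trans ?_)
  have hfm' : Measurable (Function.uncurry fun y w => (ball w t).indicator f y) :=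
    hfm.comp measurable_swap
  rw [lintegral_lintegral_swap hfm'.aemeasurable]
  calc _ ≤ ∫⁻ w in {w | infDist w S < t}, c * ∫⁻ y, (ball w (3 * t)).indicator g y ∂μ ∂μ := by
        refine setLIntegral_mono' (hN _) fun w hw => ?_
        refine (setLIntegral_le_lintegral _ _).trans ?_
        rw [lintegral_indicator measurableSet_ball, lintegral_indicator measurableSet_ball]
        exact h w hw
    _ ≤ c * (6 ^ Module.finrank ℝ E * V * ∫⁻ y in {y | infDist y S < 4 * t}, g y ∂μ) := by
        rw [lintegral_const_mul' _ _ hc]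
        gcongr
    _ = _ := by ring

end Averaging

/-- Tonelli's theorem for integrals over sublevel sets against a power weight. -/
lemma lintegral_Ioi_rpow_mul_lintegral_sublevel {α : Type*} [MeasurableSpace α]
    (μ : Measure α) [SFinite μ] {U : Set α} (hU : MeasurableSet U)
    {δ : α → ℝ} (hδ : Measurable δ) (hδ0 : ∀ x ∈ U, 0 < δ x) {f : α → ℝ≥0∞} (hf : Measurable f)
    {K q : ℝ} (hK : 0 < K) (hq : 0 < q) :
    ∫⁻ t in Ioi (0 : ℝ), ENNReal.ofReal t ^ (-q - 1) * (∫⁻ x in U ∩ {x | δ x < K * t}, f x ∂μ) =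
      ∫⁻ x in U, f x * ENNReal.ofReal ((δ x / K) ^ (-q) / q) ∂μ := by
  have hm : ∀ t, MeasurableSet {x | δ x < K * t} := fun t =>
    measurableSet_lt hδ measurable_const
  have hs : MeasurableSet {z : ℝ × α | δ z.2 < K * z.1} :=
    measurableSet_lt (by fun_prop) (by fun_prop)
  have hjm : Measurable fun z : ℝ × α =>
      ENNReal.ofReal z.1 ^ (-q - 1) * {x | δ x < K * z.1}.indicator f z.2 := by
    refine Measurable.mul (by fun_prop) ?_
    exact (hf.comp measurable_snd).indicator hs
  calc _ = ∫⁻ t in Ioi (0 : ℝ), (∫⁻ x in U,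
        ENNReal.ofReal t ^ (-q - 1) * {x | δ x < K * t}.indicator f x ∂μ) := by
        refine lintegral_congr fun t => ?_
        rw [lintegral_const_mul _ (hf.indicator (hm t)), lintegral_indicator (hm t),
          Measure.restrict_restrict (hm t), inter_comm]
    _ = ∫⁻ x in U, (∫⁻ t in Ioi (0 : ℝ),
        ENNReal.ofReal t ^ (-q - 1) * {x | δ x < K * t}.indicator f x) ∂μ :=
        lintegral_lintegral_swap hjm.aemeasurable
    _ = _ := by
        refine setLIntegral_congr_fun hU fun x hx => ?_
        have hpos : 0 < δ x / K := div_pos (hδ0 x hx) hK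
        have hsub : Ioi (δ x / K) ⊆ Ioi 0 := Ioi_subset_Ioi hpos.le
        calc _ = ∫⁻ t in Ioi (0 : ℝ), (Ioi (δ x / K)).indicator
              (fun t => f x * ENNReal.ofReal (t ^ (-q - 1))) t := by
              refine setLIntegral_congr_fun measurableSet_Ioi fun t ht => ?_
              have hiff : δ x / K < t ↔ δ x < K * t := div_lt_iff₀' hK
              by_cases h : δ x < K * t
              · rw [indicator_of_mem (by exact h), indicator_of_mem (by exact hiff.2 h),
                  ENNReal.ofReal_rpow_of_pos ht, mul_comm]
              · rw [indicator_of_notMem (by exact h),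
                  indicator_of_notMem (by exact fun h' => h (hiff.1 h')), mul_zero]
          _ = f x * ∫⁻ t in Ioi (δ x / K), ENNReal.ofReal (t ^ (-q - 1)) := by
              rw [lintegral_indicator measurableSet_Ioi,
                Measure.restrict_restrict measurableSet_Ioi, inter_eq_left.2 hsub,
                lintegral_const_mul _ (by fun_prop)]
          _ = _ := by
              rw [← ofReal_integral_eq_lintegral_ofReal
                (integrableOn_Ioi_rpow_of_lt (by linarith) hpos)
                ((ae_restrict_mem measurableSet_Ioi).mono fun t ht =>
                  Real.rpow_nonneg (hsub ht).le _),
                integral_Ioi_rpow_of_lt (by linarith) hpos]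
              congr 2
              rw [sub_add_cancel, neg_div_neg_eq]

section Sublevel

lemma enorm_fderiv_rpow_eq_zero_of_notMem_tsupport {E : Type*} [NormedAddCommGroup E]
    [NormedSpace ℝ E] {u : E → ℝ} {x : E} (hx : x ∉ tsupport u) {p : ℝ} (hp : 0 < p) :
    ‖fderiv ℝ u x‖ₑ ^ p = 0 := by
  have h : fderiv ℝ u x = 0 := image_eq_zero_of_notMem_tsupport
    fun h => hx (tsupport_fderiv_subset ℝ h)
  rw [h, ← ofReal_norm, norm_zero, ENNReal.ofReal_zero, ENNReal.zero_rpow_of_pos hp]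

lemma setLIntegral_enorm_fderiv_rpow_le_inter {E : Type*} [NormedAddCommGroup E]
    [NormedSpace ℝ E] [MeasurableSpace E] (μ : Measure E) {u : E → ℝ} {U N : Set E}
    (hu : tsupport u ⊆ U) (hU : MeasurableSet U) (hN : MeasurableSet N) {p : ℝ} (hp : 0 < p) :
    ∫⁻ x in N, ‖fderiv ℝ u x‖ₑ ^ p ∂μ ≤ ∫⁻ x in U ∩ N, ‖fderiv ℝ u x‖ₑ ^ p ∂μ := by
  rw [← lintegral_indicator hN, ← lintegral_indicator (hU.inter hN)]
  refine lintegral_mono fun x => ?_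
  by_cases hxN : x ∈ N
  · by_cases hx : x ∈ tsupport u
    · have hmem : x ∈ U ∩ N := ⟨hu hx, hxN⟩
      rw [indicator_of_mem hxN, indicator_of_mem hmem]
    · rw [indicator_of_mem hxN, enorm_fderiv_rpow_eq_zero_of_notMem_tsupport hx hp]
      exact zero_le
  · rw [indicator_of_notMem hxN]
    exact zero_le

/-- Poincaré inequality on the boundary layers of a bounded open set with fat complement. -/
lemma UniformlyFat.exists_lintegral_sublevel_le {n : ℕ} {p c₀ r₀ : ℝ}
    {Ω : Set (EuclideanSpace ℝ (Fin n))} (hfat : UniformlyFat n p c₀ r₀ Ωᶜ) (hn : 0 < n)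
    (hp : 1 ≤ p) (hc₀ : 0 < c₀) (hr₀ : 0 < r₀) (hb : Bornology.IsBounded Ω) (hopen : IsOpen Ω)
    (hfr : (frontier Ω).Nonempty) :
    ∃ A : ℝ≥0, ∃ K : ℝ, 1 ≤ K ∧ ∀ (L : ℝ≥0) (u : EuclideanSpace ℝ (Fin n) → ℝ),
      LipschitzWith L u → HasCompactSupport u → tsupport u ⊆ Ω → ∀ s : ℝ, 0 < s →
      ∫⁻ x in Ω ∩ {x | infDist x (frontier Ω) < s}, ‖u x‖ₑ ^ p ≤
        A * ENNReal.ofReal s ^ p *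
          ∫⁻ x in Ω ∩ {x | infDist x (frontier Ω) < K * s}, ‖fderiv ℝ u x‖ₑ ^ p := by
  have : Nonempty (Fin n) := ⟨⟨0, hn⟩⟩
  have hp0 : 0 < p := by linarith
  obtain ⟨A, hA⟩ := hfat.exists_lintegral_ball_le hn hp hc₀
  obtain ⟨x₀, hx₀⟩ := hfr
  obtain ⟨R, hR0, hR⟩ := hb.subset_ball_lt 0 x₀
  have hN : ∀ s, MeasurableSet {x | infDist x (frontier Ω) < s} := fun s =>
    measurableSet_lt measurable_infDist measurable_const
  refine ⟨A * 2 ^ p * 6 ^ n + (12 * R / r₀).toNNReal ^ p * 6 ^ n, max 8 (2 * R / r₀),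
    le_max_of_le_left (by norm_num), fun L u hu hcs hsupp s hs => ?_⟩
  have hcoe : ((A * 2 ^ p * 6 ^ n + (12 * R / r₀).toNNReal ^ p * 6 ^ n : ℝ≥0) : ℝ≥0∞) =
      A * 2 ^ p * 6 ^ n + ENNReal.ofReal (12 * R / r₀) ^ p * 6 ^ n := by
    push_cast [ENNReal.coe_rpow_of_nonneg _ hp0.le]
    rfl
  have hu0 : ∀ y ∉ Ω, u y = 0 := fun y hy =>
    image_eq_zero_of_notMem_tsupport fun h => hy (hsupp h)
  rw [hcoe]
  rcases le_or_gt s (r₀ / 2) with hsr | hsr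
  · have key := lintegral_thickening_le_of_ball (volume : Measure (EuclideanSpace ℝ (Fin n)))
      (S := frontier Ω)
      (f := fun x => ‖u x‖ₑ ^ p) (g := fun x => ‖fderiv ℝ u x‖ₑ ^ p)
      (hu.continuous.measurable.enorm.pow_const p) ((measurable_fderiv ℝ u).enorm.pow_const p)
      (t := 2 * s) (by positivity) (c := A * ENNReal.ofReal (2 * s) ^ p)
      (ENNReal.mul_ne_top ENNReal.coe_ne_top
        (ENNReal.rpow_ne_top_of_nonneg hp0.le ENNReal.ofReal_ne_top)) fun w hw => by
        obtain ⟨x, hx, hwx⟩ := (infDist_lt_iff ⟨x₀, hx₀⟩).1 hw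
        have h := hA x (by rwa [frontier_compl]) (2 * s) (by positivity) (by linarith) L u hu hcs
          fun y hy => hu0 y hy
        refine (lintegral_mono_set (ball_subset_ball' ?_)).trans (h.trans ?_)
        · linarith
        · gcongr
          refine ball_subset_ball' ?_
          rw [dist_comm] at hwx
          linarith
    rw [show 2 * s / 2 = s by ring, show 4 * (2 * s) = 8 * s by ring,
      finrank_euclideanSpace_fin] at key
    calc _ ≤ _ := lintegral_mono_set inter_subset_right
      _ ≤ _ := key
      _ ≤ A * ENNReal.ofReal (2 * s) ^ p * 6 ^ n *
          ∫⁻ x in Ω ∩ {x | infDist x (frontier Ω) < 8 * s}, ‖fderiv ℝ u x‖ₑ ^ p := by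
        refine mul_le_mul_right ?_ _
        exact setLIntegral_enorm_fderiv_rpow_le_inter _ hsupp hopen.measurableSet (hN _) hp0
      _ ≤ _ := by
        gcongr ?_ * ?_
        · rw [ENNReal.ofReal_mul (by norm_num), ENNReal.ofReal_ofNat,
            ENNReal.mul_rpow_of_nonneg _ _ hp0.le, add_mul]
          refine le_trans (le_of_eq (by ring)) le_self_add
        · refine lintegral_mono_set (inter_subset_inter_right _ fun x hx => ?_)
          rw [mem_ofPred_eq] at hx ⊢
          exact hx.trans_le (by gcongr; exact le_max_left _ _)
  · have h := hu.lintegral_enorm_rpow_le_of_eq_zero_off_ball volume hR0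
      (fun y hy => hu0 y fun h => hy (hR h)) hp
    rw [finrank_euclideanSpace_fin] at h
    have hKs : R < max 8 (2 * R / r₀) * s := by
      calc R = 2 * R / r₀ * (r₀ / 2) := by field_simp
        _ < 2 * R / r₀ * s := by gcongr
        _ ≤ _ := by gcongr; exact le_max_right _ _
    calc _ ≤ _ := setLIntegral_le_lintegral _ _
      _ ≤ _ := h
      _ = ENNReal.ofReal (6 * R) ^ p * 6 ^ n * ∫⁻ x in Ω, ‖fderiv ℝ u x‖ₑ ^ p := by
        rw [setLIntegral_enorm_fderiv_rpow_of_tsupport_subset _ hsupp hp0, mul_assoc]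
      _ ≤ _ := by
        gcongr ?_ * ?_
        · calc _ ≤ (ENNReal.ofReal (12 * R / r₀) * ENNReal.ofReal s) ^ p * 6 ^ n := by
                gcongr
                rw [← ENNReal.ofReal_mul (by positivity)]
                refine ENNReal.ofReal_le_ofReal ?_
                calc 6 * R = 12 * R / r₀ * (r₀ / 2) := by field_simp; norm_num
                  _ ≤ _ := by gcongr
            _ ≤ _ := by
                rw [ENNReal.mul_rpow_of_nonneg _ _ hp0.le, add_mul, add_comm]
                refine le_trans (le_of_eq (by ring)) le_self_add
        · refine lintegral_mono_set fun x hx => ⟨hx, ?_⟩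
          exact ((infDist_le_dist_of_mem hx₀).trans_lt (hR hx)).trans hKs

end Sublevel

section Hardy

lemma lintegral_mul_rpow_le_of_sublevel {α : Type*} [MeasurableSpace α] (μ : Measure α)
    [SFinite μ] {U : Set α} (hU : MeasurableSet U) {δ : α → ℝ} (hδ : Measurable δ)
    (hδ0 : ∀ x ∈ U, 0 < δ x) {f g : α → ℝ≥0∞} (hf : Measurable f) (hg : Measurable g)
    {A : ℝ≥0} {K p β : ℝ} (hK : 0 < K) (hp : 0 < p) (hβ : 0 < β)
    (h : ∀ s : ℝ, 0 < s → ∫⁻ x in U ∩ {x | δ x < s}, f x ∂μ ≤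
      A * ENNReal.ofReal s ^ p * ∫⁻ x in U ∩ {x | δ x < K * s}, g x ∂μ) :
    ∫⁻ x in U, f x * ENNReal.ofReal (δ x) ^ (-(p + β)) ∂μ ≤
      A * ENNReal.ofReal ((p + β) / β * K ^ β) *
        ∫⁻ x in U, g x * ENNReal.ofReal (δ x) ^ (-β) ∂μ := by
  have hpβ : 0 < p + β := by positivity
  have key : ∫⁻ x in U, f x * ENNReal.ofReal ((δ x / 1) ^ (-(p + β)) / (p + β)) ∂μ ≤
      A * ∫⁻ x in U, g x * ENNReal.ofReal ((δ x / K) ^ (-β) / β) ∂μ := by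
    rw [← lintegral_Ioi_rpow_mul_lintegral_sublevel μ hU hδ hδ0 hf one_pos hpβ,
      ← lintegral_Ioi_rpow_mul_lintegral_sublevel μ hU hδ hδ0 hg hK hβ,
      ← lintegral_const_mul' _ _ ENNReal.coe_ne_top]
    refine setLIntegral_mono' measurableSet_Ioi fun t (ht : 0 < t) => ?_
    have ht' : ENNReal.ofReal t ≠ 0 := by simpa using ht
    calc _ ≤ ENNReal.ofReal t ^ (-(p + β) - 1) * (A * ENNReal.ofReal t ^ p *
          ∫⁻ x in U ∩ {x | δ x < K * t}, g x ∂μ) := by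
          gcongr
          simpa using h t ht
      _ = A * (ENNReal.ofReal t ^ (-(p + β) - 1) * ENNReal.ofReal t ^ p *
          ∫⁻ x in U ∩ {x | δ x < K * t}, g x ∂μ) := by ring
      _ = _ := by
          rw [← ENNReal.rpow_add _ _ ht' ENNReal.ofReal_ne_top,
            show -(p + β) - 1 + p = -β - 1 by ring]
  have h1 : ∫⁻ x in U, f x * ENNReal.ofReal (δ x) ^ (-(p + β)) ∂μ = ENNReal.ofReal (p + β) *
      ∫⁻ x in U, f x * ENNReal.ofReal ((δ x / 1) ^ (-(p + β)) / (p + β)) ∂μ := by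
    rw [← lintegral_const_mul' _ _ ENNReal.ofReal_ne_top]
    refine setLIntegral_congr_fun hU fun x hx => ?_
    rw [mul_left_comm, ← ENNReal.ofReal_mul hpβ.le, ENNReal.ofReal_rpow_of_pos (hδ0 x hx)]
    congr 2
    field_simp
  have h2 : ∫⁻ x in U, g x * ENNReal.ofReal ((δ x / K) ^ (-β) / β) ∂μ =
      ENNReal.ofReal (K ^ β / β) * ∫⁻ x in U, g x * ENNReal.ofReal (δ x) ^ (-β) ∂μ := by
    rw [← lintegral_const_mul' _ _ ENNReal.ofReal_ne_top]
    refine setLIntegral_congr_fun hU fun x hx => ?_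
    rw [mul_left_comm, ENNReal.ofReal_rpow_of_pos (hδ0 x hx), ← ENNReal.ofReal_mul (by positivity),
      Real.div_rpow (hδ0 x hx).le hK.le, Real.rpow_neg hK.le]
    congr 2
    field_simp
  rw [h1]
  rw [h2] at key
  refine (mul_le_mul_right key _).trans (le_of_eq ?_)
  rw [show (p + β) / β * K ^ β = (p + β) * (K ^ β / β) by ring, ENNReal.ofReal_mul hpβ.le]
  ring

lemma enorm_rpow_mul_rpow_neg_le {F G : Type*} [SeminormedAddCommGroup F]
    [SeminormedAddCommGroup G] {D : F} {V : G} {a d p β : ℝ} (hd : 0 < d) (hp : 1 ≤ p)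
    (hβ : 0 < β) (h : ‖D‖ ≤ ‖V‖ * d ^ (β / p) + β / p * |a| * d ^ (β / p - 1)) :
    ‖D‖ₑ ^ p * ENNReal.ofReal d ^ (-β) ≤ ENNReal.ofReal (2 ^ (p - 1)) *
      (‖V‖ₑ ^ p + ENNReal.ofReal ((β / p) ^ p) * (‖a‖ₑ ^ p * ENNReal.ofReal d ^ (-p))) := by
  have hp0 : 0 < p := by linarith
  have hd' : ENNReal.ofReal d ≠ 0 := by simpa using hd
  have hdt : ENNReal.ofReal d ≠ ∞ := ENNReal.ofReal_ne_top
  have h1 : ‖D‖ₑ ≤ ‖V‖ₑ * ENNReal.ofReal d ^ (β / p) +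
      ENNReal.ofReal (β / p) * ‖a‖ₑ * ENNReal.ofReal d ^ (β / p - 1) := by
    rw [← ofReal_norm, ← ofReal_norm V, ← ofReal_norm a, ENNReal.ofReal_rpow_of_pos hd,
      ENNReal.ofReal_rpow_of_pos hd, ← ENNReal.ofReal_mul (norm_nonneg _),
      ← ENNReal.ofReal_mul (by positivity), ← ENNReal.ofReal_mul (by positivity),
      ← ENNReal.ofReal_add (by positivity) (by positivity)]
    exact ENNReal.ofReal_le_ofReal h
  calc _ ≤ (‖V‖ₑ * ENNReal.ofReal d ^ (β / p) +
        ENNReal.ofReal (β / p) * ‖a‖ₑ * ENNReal.ofReal d ^ (β / p - 1)) ^ p *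
          ENNReal.ofReal d ^ (-β) := by gcongr
    _ ≤ 2 ^ (p - 1) * ((‖V‖ₑ * ENNReal.ofReal d ^ (β / p)) ^ p +
        (ENNReal.ofReal (β / p) * ‖a‖ₑ * ENNReal.ofReal d ^ (β / p - 1)) ^ p) *
          ENNReal.ofReal d ^ (-β) := by
        gcongr
        exact ENNReal.rpow_add_le_mul_rpow_add_rpow _ _ hp
    _ = _ := by
        rw [← ENNReal.ofReal_rpow_of_pos two_pos, ENNReal.ofReal_ofNat,
          ENNReal.mul_rpow_of_nonneg _ _ hp0.le, ENNReal.mul_rpow_of_nonneg _ _ hp0.le,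
          ENNReal.mul_rpow_of_nonneg _ _ hp0.le, ← ENNReal.rpow_mul, ← ENNReal.rpow_mul,
          ENNReal.ofReal_rpow_of_pos (show 0 < β / p by positivity),
          div_mul_cancel₀ _ hp0.ne',
          show (β / p - 1) * p = β + -p by field_simp; ring, mul_assoc, add_mul,
          ENNReal.rpow_add _ _ hd' hdt, ENNReal.rpow_neg _ β]
        have hc := ENNReal.mul_inv_cancel (a := ENNReal.ofReal d ^ β)
          (by simp [ENNReal.rpow_eq_zero_iff, hd, hβ.not_gt])
          (ENNReal.rpow_ne_top_of_nonneg hβ.le hdt)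
        set e := ENNReal.ofReal d ^ β
        calc _ = 2 ^ (p - 1) * (‖V‖ₑ ^ p * (e * e⁻¹) + ENNReal.ofReal ((β / p) ^ p) * ‖a‖ₑ ^ p *
              ENNReal.ofReal d ^ (-p) * (e * e⁻¹)) := by ring
          _ = _ := by rw [hc]; ring

lemma exists_pos_mul_rpow_le_half (A : ℝ) {K p : ℝ} (hK : 0 < K) (hp : 1 < p) :
    ∃ β : ℝ, 0 < β ∧ A * ((p + β) / β * K ^ β) * 2 ^ (p - 1) * (β / p) ^ p ≤ 1 / 2 := by
  have hc : ContinuousAt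
      (fun β : ℝ => A * ((p + β) * K ^ β) * 2 ^ (p - 1) * (β ^ (p - 1) / p ^ p)) 0 := by
    have h1 : ContinuousAt (fun β : ℝ => K ^ β) 0 := Real.continuousAt_const_rpow hK.ne'
    have h2 : ContinuousAt (fun β : ℝ => β ^ (p - 1)) 0 :=
      Real.continuousAt_rpow_const _ _ (Or.inr (by linarith))
    fun_prop
  have h0 : (fun β : ℝ => A * ((p + β) * K ^ β) * 2 ^ (p - 1) * (β ^ (p - 1) / p ^ p)) 0
      < 1 / 2 := by
    simp [Real.zero_rpow (by linarith : p - 1 ≠ 0)]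
  have hev := (hc.eventually_lt continuousAt_const h0).filter_mono
    (nhdsWithin_le_nhds (s := Ioi (0 : ℝ)))
  obtain ⟨β, hβ, hβ0⟩ := (hev.and self_mem_nhdsWithin).exists
  have hβ0 : 0 < β := hβ0
  refine ⟨β, hβ0, le_of_eq_of_le ?_ hβ.le⟩
  rw [Real.div_rpow hβ0.le (by linarith), Real.rpow_sub_one hβ0.ne']
  field_simp

variable {E : Type*} [NormedAddCommGroup E] [NormedSpace ℝ E]

lemma LipschitzWith.norm_fderiv_mul_rpow_le {δ u : E → ℝ} (hδ : LipschitzWith 1 δ) {x : E}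
    (hx : 0 < δ x) (hdδ : DifferentiableAt ℝ δ x) (hdu : DifferentiableAt ℝ u x) {a : ℝ}
    (ha : 0 ≤ a) :
    ‖fderiv ℝ (fun y => u y * δ y ^ a) x‖ ≤
      ‖fderiv ℝ u x‖ * δ x ^ a + a * |u x| * δ x ^ (a - 1) := by
  have h := (hdu.hasFDerivAt.mul (hdδ.hasFDerivAt.rpow_const (p := a) (Or.inl hx.ne'))).fderiv
  have hn : ‖fderiv ℝ δ x‖ ≤ 1 := by simpa using norm_fderiv_le_of_lipschitz ℝ (x₀ := x) hδ
  have e : (fun y => u y * δ y ^ a) = u * fun y => δ y ^ a := rfl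
  rw [e, h]
  refine (norm_add_le _ _).trans ?_
  rw [norm_smul, norm_smul, norm_smul, Real.norm_eq_abs, Real.norm_of_nonneg (by positivity),
    Real.norm_of_nonneg (by positivity), add_comm]
  refine add_le_add (le_of_eq (mul_comm _ _)) ?_
  calc |u x| * (a * δ x ^ (a - 1) * ‖fderiv ℝ δ x‖) ≤ |u x| * (a * δ x ^ (a - 1) * 1) := by
        gcongr
    _ = _ := by ring

omit [NormedSpace ℝ E] in
lemma LipschitzWith.exists_lipschitzWith_eq_rpow {δ : E → ℝ} (hδ : LipschitzWith 1 δ) {ε R : ℝ}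
    (hε : 0 < ε) (hR : ε ≤ R) (a : ℝ) :
    ∃ (B L : ℝ≥0) (h : E → ℝ), LipschitzWith L h ∧ (∀ x, |h x| ≤ B) ∧
      ∀ x, ε ≤ δ x → δ x ≤ R → h x = δ x ^ a := by
  have hcd : ContDiffOn ℝ 1 (fun t : ℝ => t ^ a) (Icc ε R) := fun t ht =>
    (Real.contDiffAt_rpow_const_of_ne (hε.trans_le ht.1).ne').contDiffWithinAt
  obtain ⟨L, hL⟩ := hcd.exists_lipschitzOnWith one_ne_zero (convex_Icc _ _) isCompact_Icc
  obtain ⟨B, hB⟩ := isCompact_Icc.exists_bound_of_continuousOn hcd.continuousOn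
  have hmem : ∀ x, max ε (min (δ x) R) ∈ Icc ε R := fun x =>
    ⟨le_max_left _ _, max_le hR (min_le_right _ _)⟩
  refine ⟨B.toNNReal, L * 1, fun x => max ε (min (δ x) R) ^ a, ?_, fun x => ?_, fun x h1 h2 => ?_⟩
  · refine lipschitzOnWith_univ.1 (hL.comp (g := fun t => t ^ a)
      (lipschitzOnWith_univ.2 ((hδ.min_const R).const_max ε)) fun x _ => hmem x)
  · exact (hB _ (hmem x)).trans (Real.le_coe_toNNReal B)
  · simp only [min_eq_left h2, max_eq_right h1]

variable [FiniteDimensional ℝ E] [MeasurableSpace E] [BorelSpace E] (μ : Measure E)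
  [μ.IsAddHaarMeasure]

/-- Hardy's inequality follows from the Poincaré inequality on boundary layers. -/
theorem exists_hardy_of_sublevel {U : Set E} (hU : IsOpen U) {δ : E → ℝ}
    (hδ : LipschitzWith 1 δ) (hδ0 : ∀ x ∈ U, 0 < δ x) {A : ℝ≥0} {K p : ℝ} (hK : 0 < K)
    (hp : 1 < p)
    (h : ∀ (L : ℝ≥0) (u : E → ℝ), LipschitzWith L u → HasCompactSupport u → tsupport u ⊆ U →
      ∀ s : ℝ, 0 < s → ∫⁻ x in U ∩ {x | δ x < s}, ‖u x‖ₑ ^ p ∂μ ≤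
        A * ENNReal.ofReal s ^ p * ∫⁻ x in U ∩ {x | δ x < K * s}, ‖fderiv ℝ u x‖ₑ ^ p ∂μ) :
    ∃ C : ℝ≥0, ∀ (L : ℝ≥0) (u : E → ℝ), LipschitzWith L u → HasCompactSupport u →
      tsupport u ⊆ U →
      ∫⁻ x in U, ‖u x‖ₑ ^ p * ENNReal.ofReal (δ x) ^ (-p) ∂μ ≤
        C * ∫⁻ x in U, ‖fderiv ℝ u x‖ₑ ^ p ∂μ := by
  have hp0 : 0 < p := by linarith
  obtain ⟨β, hβ, hsmall⟩ := exists_pos_mul_rpow_le_half A hK hp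
  set D : ℝ := A * ((p + β) / β * K ^ β) * 2 ^ (p - 1) with hD
  have hD0 : 0 ≤ D := by positivity
  refine ⟨(2 * D).toNNReal, fun L u hu hcs hsupp => ?_⟩
  set G := ∫⁻ x in U, ‖fderiv ℝ u x‖ₑ ^ p ∂μ with hG
  set X := ∫⁻ x in U, ‖u x‖ₑ ^ p * ENNReal.ofReal (δ x) ^ (-p) ∂μ with hX
  have hδc := hδ.continuous
  obtain ⟨ε, hε, hεu⟩ := hcs.isCompact.exists_forall_le' hδc.continuousOn
    fun x hx => hδ0 x (hsupp hx)
  obtain ⟨R, hR⟩ := hcs.isCompact.exists_bound_of_continuousOn hδc.continuousOn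
  have hRu : ∀ x ∈ tsupport u, δ x < max (R + 1) ε := fun x hx =>
    ((le_abs_self _).trans_lt ((hR x hx).trans_lt (lt_add_one R))).trans_le (le_max_left _ _)
  have hu0 : ∀ x ∉ tsupport u, u x = 0 := fun x hx => image_eq_zero_of_notMem_tsupport hx
  obtain ⟨B, L', w, hw, hwB, hweq⟩ := hδ.exists_lipschitzWith_eq_rpow (half_pos hε)
    ((half_le_self hε.le).trans (le_max_right (R + 1) ε)) (β / p)
  obtain ⟨M, hM⟩ := hcs.exists_bound_of_continuous hu.continuous
  set f : E → ℝ := fun x => u x * w x with hf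
  have hfL := hu.mul_of_bound hw (A := M.toNNReal) (B := B)
    (fun x => (hM x).trans (Real.le_coe_toNNReal M)) hwB
  have hfcs : HasCompactSupport f := hcs.mul_right
  have hfsupp : tsupport f ⊆ tsupport u := tsupport_mul_subset_left
  have hXtop : X ≠ ∞ := by
    have hmem : MemLp u (ENNReal.ofReal p) μ := hu.continuous.memLp_of_hasCompactSupport hcs
    have hfin : ∫⁻ x, ‖u x‖ₑ ^ p ∂μ < ∞ := by
      have := lintegral_rpow_enorm_lt_top_of_eLpNorm_lt_top (by positivity)
        ENNReal.ofReal_ne_top hmem.eLpNorm_lt_top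
      rwa [ENNReal.toReal_ofReal hp0.le] at this
    refine ne_top_of_le_ne_top (b := ENNReal.ofReal (ε ^ (-p)) * ∫⁻ x, ‖u x‖ₑ ^ p ∂μ)
      (ENNReal.mul_ne_top ENNReal.ofReal_ne_top hfin.ne) ?_
    rw [← lintegral_const_mul' _ _ ENNReal.ofReal_ne_top]
    refine (setLIntegral_le_lintegral _ _).trans (lintegral_mono fun x => ?_)
    by_cases hx : x ∈ tsupport u
    · beta_reduce
      rw [mul_comm, ENNReal.ofReal_rpow_of_pos (hε.trans_le (hεu x hx))]
      refine mul_le_mul_left (ENNReal.ofReal_le_ofReal ?_) _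
      exact Real.rpow_le_rpow_of_nonpos hε (hεu x hx) (by linarith)
    · simp [hu0 x hx, hp0]
  have hleft : X = ∫⁻ x in U, ‖f x‖ₑ ^ p * ENNReal.ofReal (δ x) ^ (-(p + β)) ∂μ := by
    refine setLIntegral_congr_fun hU.measurableSet fun x hxU => ?_
    by_cases hx : x ∈ tsupport u
    · have hδx := hδ0 x hxU
      have hδx' : ENNReal.ofReal (δ x) ≠ 0 := by simpa using hδx
      have e : ‖w x‖ₑ ^ p = ENNReal.ofReal (δ x) ^ β := by
        rw [hweq x (by linarith [hεu x hx]) (hRu x hx).le, Real.enorm_of_nonneg (by positivity),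
          ENNReal.ofReal_rpow_of_nonneg (by positivity) hp0.le, ← Real.rpow_mul hδx.le,
          div_mul_cancel₀ _ hp0.ne', ENNReal.ofReal_rpow_of_pos hδx]
      simp only [hf, enorm_mul]
      rw [ENNReal.mul_rpow_of_nonneg _ _ hp0.le, e, mul_assoc,
        ← ENNReal.rpow_add _ _ hδx' ENNReal.ofReal_ne_top, show β + -(p + β) = -p by ring]
    · simp [hf, hu0 x hx, hp0]
  have hright : ∫⁻ x in U, ‖fderiv ℝ f x‖ₑ ^ p * ENNReal.ofReal (δ x) ^ (-β) ∂μ ≤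
      ENNReal.ofReal (2 ^ (p - 1)) * (G + ENNReal.ofReal ((β / p) ^ p) * X) := by
    rw [hG, hX, ← lintegral_const_mul' _ _ ENNReal.ofReal_ne_top,
      ← lintegral_add_left ((measurable_fderiv ℝ u).enorm.pow_const p),
      ← lintegral_const_mul' _ _ ENNReal.ofReal_ne_top]
    refine lintegral_mono_ae ?_
    filter_upwards [ae_restrict_mem hU.measurableSet,
      ae_restrict_of_ae (hu.ae_differentiableAt (μ := μ)),
      ae_restrict_of_ae (hδ.ae_differentiableAt (μ := μ))] with x hxU hdu hdδ
    by_cases hx : x ∈ tsupport u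
    · have hδx := hδ0 x hxU
      have hev : f =ᶠ[𝓝 x] fun y => u y * δ y ^ (β / p) := by
        filter_upwards [hδc.continuousAt.eventually (lt_mem_nhds
          ((half_lt_self hε).trans_le (hεu x hx))),
          hδc.continuousAt.eventually (gt_mem_nhds (hRu x hx))] with y hy1 hy2
        simp only [hf, hweq y hy1.le hy2.le]
      have hle := hδ.norm_fderiv_mul_rpow_le hδx hdδ hdu (a := β / p) (by positivity)
      rw [← hev.fderiv_eq] at hle
      exact enorm_rpow_mul_rpow_neg_le hδx hp.le hβ hle
    · rw [enorm_fderiv_rpow_eq_zero_of_notMem_tsupport (fun h => hx (hfsupp h)) hp0, zero_mul]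
      exact zero_le
  have key := lintegral_mul_rpow_le_of_sublevel μ hU.measurableSet hδc.measurable hδ0
    (f := fun x => ‖f x‖ₑ ^ p) (g := fun x => ‖fderiv ℝ f x‖ₑ ^ p)
    (hfL.continuous.measurable.enorm.pow_const p)
    ((measurable_fderiv ℝ f).enorm.pow_const p) hK hp0 hβ (h _ f hfL hfcs (hfsupp.trans hsupp))
  rw [← hleft] at key
  have hDe : (A : ℝ≥0∞) * ENNReal.ofReal ((p + β) / β * K ^ β) * ENNReal.ofReal (2 ^ (p - 1)) =
      ENNReal.ofReal D := by
    rw [hD, ENNReal.ofReal_mul (q := 2 ^ (p - 1)) (by positivity), ENNReal.ofReal_mul A.coe_nonneg,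
      ENNReal.ofReal_coe_nnreal]
  have hhalf : X / 2 + X / 2 ≤ ENNReal.ofReal D * G + X / 2 := by
    rw [ENNReal.add_halves]
    calc X ≤ _ := key
      _ ≤ _ := mul_le_mul_right hright _
      _ = ENNReal.ofReal D * G + ENNReal.ofReal (D * (β / p) ^ p) * X := by
        rw [← mul_assoc, hDe, mul_add, ENNReal.ofReal_mul hD0, mul_assoc]
      _ ≤ ENNReal.ofReal D * G + ENNReal.ofReal (1 / 2) * X := by gcongr
      _ = _ := by
        rw [ENNReal.ofReal_div_of_pos two_pos, ENNReal.ofReal_one, ENNReal.ofReal_ofNat,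
          one_div, mul_comm _ X, div_eq_mul_inv]
  have h2 : X / 2 ≤ ENNReal.ofReal D * G :=
    ENNReal.le_of_add_le_add_right (ENNReal.div_ne_top hXtop two_ne_zero) hhalf
  calc X = 2 * (X / 2) := (ENNReal.mul_div_cancel two_ne_zero (by simp)).symm
    _ ≤ 2 * (ENNReal.ofReal D * G) := by gcongr
    _ = _ := by
      rw [← mul_assoc]
      congr 1
      change _ = ENNReal.ofReal (2 * D)
      rw [ENNReal.ofReal_mul two_pos.le, ENNReal.ofReal_ofNat]

end Hardy

section WeakLebesgue

/-- Integrals over sets of finite measure of a function in weak `L^q`. -/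
lemma setLIntegral_le_of_meas_gt_le {α : Type*} [MeasurableSpace α] (μ : Measure α)
    {w : α → ℝ} (hw : Measurable w) (hw0 : ∀ x, 0 ≤ w x) {M q : ℝ} (hM : 0 < M) (hq : 1 < q)
    (h : ∀ t : ℝ, 0 < t → μ {x | t < w x} ≤ ENNReal.ofReal ((M / t) ^ q)) {S : Set α}
    (hS : μ S ≠ ∞) :
    ∫⁻ x in S, ENNReal.ofReal (w x) ∂μ ≤ ENNReal.ofReal (M * (q / (q - 1))) * μ S ^ (1 - 1 / q) := by
  have hq0 : 0 < q := by linarith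
  have hq1 : 0 < q - 1 := by linarith
  by_cases hS0 : μ S = 0
  · rw [setLIntegral_measure_zero S _ hS0]
    exact zero_le
  set s := (μ S).toReal with hs
  have hs0 : 0 < s := ENNReal.toReal_pos hS0 hS
  have hsS : μ S = ENNReal.ofReal s := (ENNReal.ofReal_toReal hS).symm
  set T := M * s ^ (-1 / q) with hT
  have hT0 : 0 < T := by positivity
  rw [lintegral_eq_lintegral_meas_lt _ (ae_of_all _ hw0) hw.aemeasurable,
    ← Ioc_union_Ioi_eq_Ioi hT0.le, lintegral_union measurableSet_Ioi (Ioc_disjoint_Ioi le_rfl)]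
  have h1 : ∫⁻ t in Ioc 0 T, μ.restrict S {x | t < w x} ≤ ENNReal.ofReal (s * T) := by
    calc _ ≤ ∫⁻ t in Ioc 0 T, μ S := lintegral_mono fun t =>
          (measure_mono (subset_univ _)).trans (by rw [Measure.restrict_apply_univ])
      _ = _ := by
        rw [setLIntegral_const, Real.volume_Ioc, sub_zero, hsS, ENNReal.ofReal_mul hs0.le]
  have h2 : ∫⁻ t in Ioi T, μ.restrict S {x | t < w x} ≤
      ENNReal.ofReal (M ^ q * (T ^ (1 - q) / (q - 1))) := by
    calc _ ≤ ∫⁻ t in Ioi T, ENNReal.ofReal (M ^ q * t ^ (-q)) := by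
          refine setLIntegral_mono' measurableSet_Ioi fun t (ht : T < t) => ?_
          have ht0 := hT0.trans ht
          refine (Measure.restrict_apply_le _ _).trans ((h t ht0).trans (le_of_eq ?_))
          rw [Real.div_rpow hM.le ht0.le, Real.rpow_neg ht0.le, div_eq_mul_inv]
      _ = _ := by
          rw [← ofReal_integral_eq_lintegral_ofReal
            ((integrableOn_Ioi_rpow_of_lt (by linarith) hT0).const_mul _)
            ((ae_restrict_mem measurableSet_Ioi).mono fun t (ht : T < t) => ?_),
            integral_const_mul, integral_Ioi_rpow_of_lt (by linarith) hT0]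
          · congr 2
            rw [← neg_div_neg_eq, neg_neg]
            congr 2 <;> ring
          · have := hT0.trans ht
            exact mul_nonneg (by positivity) (by positivity)
  refine (add_le_add h1 h2).trans (le_of_eq ?_)
  rw [← ENNReal.ofReal_add (by positivity) (by positivity), hsS, ENNReal.ofReal_rpow_of_pos hs0,
    ← ENNReal.ofReal_mul (by positivity)]
  congr 1
  have e1 : s * T = M * s ^ (1 - 1 / q) := by
    rw [hT, mul_left_comm]
    nth_rw 1 [← Real.rpow_one s]
    rw [← Real.rpow_add hs0]
    ring_nf
  have e2 : M ^ q * T ^ (1 - q) = M * s ^ (1 - 1 / q) := by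
    rw [hT, Real.mul_rpow hM.le (by positivity), ← mul_assoc, ← Real.rpow_add hM,
      ← Real.rpow_mul hs0.le, show q + (1 - q) = 1 by ring, Real.rpow_one]
    congr 2
    field_simp
    ring
  rw [mul_div_assoc', e1, e2]
  field_simp
  ring

lemma exists_contDiff_transition :
    ∃ (η : ℝ → ℝ) (B : ℝ), ContDiff ℝ 1 η ∧ η 0 = 0 ∧ (∀ s, 2 ≤ |s| → η s = 1) ∧
      (∀ s, |deriv η s| ≤ B) ∧ ∀ s, ¬ (1 ≤ |s| ∧ |s| ≤ 2) → deriv η s = 0 := by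
  set η : ℝ → ℝ := fun s => Real.smoothTransition ((s ^ 2 - 1) / 3) with hη
  have hcd : ContDiff ℝ 1 η :=
    Real.smoothTransition.contDiff.comp (by fun_prop : ContDiff ℝ 1 fun s : ℝ => (s ^ 2 - 1) / 3)
  have h0 : ∀ s : ℝ, |s| ≤ 1 → η s = 0 := fun s hs => by
    have : s ^ 2 ≤ 1 := (sq_le_one_iff_abs_le_one s).2 hs
    exact Real.smoothTransition.zero_of_nonpos (by linarith)
  have h1 : ∀ s : ℝ, 2 ≤ |s| → η s = 1 := fun s hs => by
    have : (2 : ℝ) ^ 2 ≤ s ^ 2 := sq_le_sq' (by linarith [abs_nonneg s]) hs |>.trans_eq (sq_abs s)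
    exact Real.smoothTransition.one_of_one_le (by linarith)
  have hd : ∀ s, ¬ (1 ≤ |s| ∧ |s| ≤ 2) → deriv η s = 0 := fun s hs => by
    rcases lt_or_ge |s| 1 with h | h
    · have : η =ᶠ[𝓝 s] fun _ => 0 := by
        filter_upwards [continuous_abs.continuousAt.eventually (gt_mem_nhds h)] with y hy
          using h0 y hy.le
      rw [this.deriv_eq, deriv_const]
    · have h' : 2 < |s| := not_le.1 fun h'' => hs ⟨h, h''⟩
      have : η =ᶠ[𝓝 s] fun _ => 1 := by
        filter_upwards [continuous_abs.continuousAt.eventually (lt_mem_nhds h')] with y hy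
          using h1 y hy.le
      rw [this.deriv_eq, deriv_const]
  obtain ⟨B, hB⟩ := isCompact_Icc.exists_bound_of_continuousOn (s := Icc (-2 : ℝ) 2)
    (hcd.continuous_deriv le_rfl).continuousOn
  have hB0 : 0 ≤ B := (norm_nonneg _).trans (hB 0 (by norm_num))
  refine ⟨η, B, hcd, h0 0 (by simp), h1, fun s => ?_, hd⟩
  by_cases hs : |s| ≤ 2
  · exact hB s (abs_le.1 hs)
  · rw [hd s fun h => hs h.2, abs_zero]
    exact hB0

variable {E : Type*} [NormedAddCommGroup E] [NormedSpace ℝ E] [FiniteDimensional ℝ E]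
  [MeasurableSpace E] [BorelSpace E] (μ : Measure E) [μ.IsAddHaarMeasure]

/-- The Sobolev inequality applied to truncations. -/
lemma exists_meas_superlevel_rpow_le {p : ℝ} (hp : 1 ≤ p) (hpd : p < Module.finrank ℝ E) :
    ∃ C : ℝ≥0, ∀ φ : E → ℝ, ContDiff ℝ 1 φ → HasCompactSupport φ → ∀ t : ℝ, 0 < t →
      μ {x | 2 * t ≤ |φ x|} ^ (1 - p / Module.finrank ℝ E) ≤
        C * ENNReal.ofReal t ^ (-p) *
          ∫⁻ x in {x | t ≤ |φ x| ∧ |φ x| ≤ 2 * t}, ‖fderiv ℝ φ x‖ₑ ^ p ∂μ := by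
  have hp0 : 0 < p := by linarith
  set d := Module.finrank ℝ E with hd
  have hd0 : (0 : ℝ) < d := hp0.trans hpd
  obtain ⟨η, B, hη, hη0, hη1, hηB, hη'⟩ := exists_contDiff_transition
  have hB0 : 0 ≤ B := (abs_nonneg _).trans (hηB 0)
  have hp'0 : 0 < p⁻¹ - (d : ℝ)⁻¹ := sub_pos.2 (inv_strictAnti₀ hp0 hpd)
  set p' := (p⁻¹ - (d : ℝ)⁻¹)⁻¹ with hp'
  have hp'pos : 0 < p' := inv_pos.2 hp'0
  set S := SNormLESNormFDerivOfEqConst ℝ μ p with hS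
  refine ⟨S ^ p * B.toNNReal ^ p, fun φ hφ hcs t ht => ?_⟩
  set g : E → ℝ := fun x => η (t⁻¹ * φ x) with hg
  have hgd : ContDiff ℝ 1 g := hη.comp (contDiff_const.mul hφ)
  have hgcs : HasCompactSupport g :=
    hcs.comp_left (g := fun s => η (t⁻¹ * s)) (by rw [mul_zero, hη0])
  have hsob : eLpNorm g (p'.toNNReal : ℝ≥0∞) μ ≤ S * eLpNorm (fderiv ℝ g) (p.toNNReal : ℝ≥0∞) μ := by
    have h := eLpNorm_le_eLpNorm_fderiv_of_eq (μ := μ) hgd hgcs (p := p.toNNReal)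
      (p' := p'.toNNReal) (by simpa using hp) (by exact_mod_cast hd0)
      (by rw [NNReal.coe_inv, Real.coe_toNNReal _ hp0.le, Real.coe_toNNReal _ hp'pos.le, hp', inv_inv])
    rwa [Real.coe_toNNReal _ hp0.le] at h
  have hmarkov : μ {x | 2 * t ≤ |φ x|} ≤ eLpNorm g (p'.toNNReal : ℝ≥0∞) μ ^ p' := by
    have h := mul_meas_ge_le_pow_eLpNorm' μ (p := (p'.toNNReal : ℝ≥0∞)) (by simpa using hp'pos)
      ENNReal.coe_ne_top hgd.continuous.aestronglyMeasurable 1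
    rw [ENNReal.one_rpow, one_mul, ENNReal.coe_toReal, Real.coe_toNNReal _ hp'pos.le] at h
    refine (measure_mono fun x hx => ?_).trans h
    rw [mem_ofPred_eq] at hx ⊢
    have : g x = 1 := hη1 _ (by
      rw [abs_mul, abs_of_pos (inv_pos.2 ht), ← div_eq_inv_mul, le_div_iff₀ ht]
      exact hx)
    rw [this]
    simp
  have hgrad : ∀ x, ‖fderiv ℝ g x‖ₑ ^ p ≤ {x | t ≤ |φ x| ∧ |φ x| ≤ 2 * t}.indicator
      (fun x => ENNReal.ofReal (B / t) ^ p * ‖fderiv ℝ φ x‖ₑ ^ p) x := by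
    intro x
    have hφx : DifferentiableAt ℝ φ x := (hφ.differentiable one_ne_zero) x
    have hηx : DifferentiableAt ℝ η (t⁻¹ * φ x) := (hη.differentiable one_ne_zero) _
    have hder : fderiv ℝ g x = deriv η (t⁻¹ * φ x) • t⁻¹ • fderiv ℝ φ x :=
      (hηx.hasDerivAt.comp_hasFDerivAt x (hφx.hasFDerivAt.const_mul t⁻¹)).fderiv
    have hn : ‖fderiv ℝ g x‖ = |deriv η (t⁻¹ * φ x)| * (t⁻¹ * ‖fderiv ℝ φ x‖) := by
      rw [hder, norm_smul, norm_smul, Real.norm_eq_abs, Real.norm_of_nonneg (inv_pos.2 ht).le]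
    by_cases hx : t ≤ |φ x| ∧ |φ x| ≤ 2 * t
    · rw [indicator_of_mem (by exact hx), ← ENNReal.mul_rpow_of_nonneg _ _ hp0.le]
      gcongr
      rw [← ofReal_norm, ← ofReal_norm, ← ENNReal.ofReal_mul (by positivity), hn]
      refine ENNReal.ofReal_le_ofReal ?_
      rw [div_eq_mul_inv, mul_assoc]
      gcongr
      exact hηB _
    · have h0 : deriv η (t⁻¹ * φ x) = 0 := hη' _ fun h => hx (by
        rw [abs_mul, abs_of_pos (inv_pos.2 ht), ← div_eq_inv_mul, le_div_iff₀ ht, one_mul,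
          div_le_iff₀ ht] at h
        exact h)
      rw [← ofReal_norm, hn, h0, abs_zero, zero_mul, ENNReal.ofReal_zero,
        ENNReal.zero_rpow_of_pos hp0]
      exact zero_le
  have hm : MeasurableSet {x | t ≤ |φ x| ∧ |φ x| ≤ 2 * t} :=
    (measurableSet_le measurable_const hφ.continuous.abs.measurable).inter
      (measurableSet_le hφ.continuous.abs.measurable measurable_const)
  have hnorm : eLpNorm (fderiv ℝ g) (p.toNNReal : ℝ≥0∞) μ ^ p = ∫⁻ x, ‖fderiv ℝ g x‖ₑ ^ p ∂μ := by
    rw [eLpNorm_eq_lintegral_rpow_enorm_toReal (by simpa using hp0) ENNReal.coe_ne_top,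
      ENNReal.coe_toReal, Real.coe_toNNReal _ hp0.le, ← ENNReal.rpow_mul,
      one_div_mul_cancel hp0.ne', ENNReal.rpow_one]
  have hexp : 1 - p / d = p / p' := by
    rw [hp', div_inv_eq_mul, mul_sub, mul_inv_cancel₀ hp0.ne', div_eq_mul_inv]
  calc _ ≤ (eLpNorm g (p'.toNNReal : ℝ≥0∞) μ ^ p') ^ (p / p') := by
        rw [hexp]
        gcongr
    _ = eLpNorm g (p'.toNNReal : ℝ≥0∞) μ ^ p := by
        rw [← ENNReal.rpow_mul, mul_div_cancel₀ _ hp'pos.ne']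
    _ ≤ (S * eLpNorm (fderiv ℝ g) (p.toNNReal : ℝ≥0∞) μ) ^ p := by gcongr
    _ = (S : ℝ≥0∞) ^ p * ∫⁻ x, ‖fderiv ℝ g x‖ₑ ^ p ∂μ := by
        rw [ENNReal.mul_rpow_of_nonneg _ _ hp0.le, hnorm]
    _ ≤ (S : ℝ≥0∞) ^ p * ∫⁻ x, {x | t ≤ |φ x| ∧ |φ x| ≤ 2 * t}.indicator
          (fun x => ENNReal.ofReal (B / t) ^ p * ‖fderiv ℝ φ x‖ₑ ^ p) x ∂μ :=
        mul_le_mul_right (lintegral_mono hgrad) _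
    _ = _ := by
        rw [lintegral_indicator hm, lintegral_const_mul' _ _
          (ENNReal.rpow_ne_top_of_nonneg hp0.le ENNReal.ofReal_ne_top),
          ENNReal.ofReal_div_of_pos ht, ENNReal.div_rpow_of_nonneg _ _ hp0.le, ENNReal.rpow_neg,
          ENNReal.coe_mul, ENNReal.coe_rpow_of_nonneg _ hp0.le, ENNReal.coe_rpow_of_nonneg _ hp0.le,
          div_eq_mul_inv]
        change _ = (S : ℝ≥0∞) ^ p * ENNReal.ofReal B ^ p * _ * _
        ring

end WeakLebesgue

section Trace

lemma setLIntegral_inv_le_one (a : ℝ) :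
    ∫⁻ t in Ioi (0 : ℝ), {t | t ≤ a ∧ a ≤ 2 * t}.indicator (fun t => ENNReal.ofReal t ^ (-1 : ℝ)) t
      ≤ 1 := by
  rcases le_or_gt a 0 with ha | ha
  · refine le_of_eq_of_le ?_ (zero_le (a := (1 : ℝ≥0∞)))
    rw [setLIntegral_congr_fun (g := fun _ => 0) measurableSet_Ioi fun t (ht : 0 < t) =>
      indicator_of_notMem (fun h => ht.not_ge (h.1.trans ha)) _, lintegral_zero]
  · calc _ ≤ ∫⁻ t, (Icc (a / 2) a).indicator (fun _ => ENNReal.ofReal (a / 2) ^ (-1 : ℝ)) t := by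
          refine (setLIntegral_le_lintegral _ _).trans (lintegral_mono fun t => ?_)
          by_cases h : t ≤ a ∧ a ≤ 2 * t
          · rw [indicator_of_mem (by exact h), indicator_of_mem
                (show t ∈ Icc (a / 2) a from ⟨by linarith, h.1⟩),
              ENNReal.rpow_neg_one, ENNReal.rpow_neg_one]
            exact ENNReal.inv_le_inv.2 (ENNReal.ofReal_le_ofReal (by linarith))
          · rw [indicator_of_notMem (by exact h)]
            exact zero_le
      _ = 1 := by
          rw [lintegral_indicator measurableSet_Icc, setLIntegral_const, Real.volume_Icc,
            ENNReal.rpow_neg_one, sub_half]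
          exact ENNReal.inv_mul_cancel (by simpa using ha) ENNReal.ofReal_ne_top

variable {E : Type*} [NormedAddCommGroup E] [NormedSpace ℝ E] [FiniteDimensional ℝ E]
  [MeasurableSpace E] [BorelSpace E] (μ : Measure E) [μ.IsAddHaarMeasure]

/-- A trace inequality for measures dominated by a power of Lebesgue measure. -/
theorem exists_trace_of_measure_le {p : ℝ} (hp : 1 ≤ p) (hpd : p < Module.finrank ℝ E)
    (ν : Measure E) (A : ℝ≥0)
    (hν : ∀ S, μ S ≠ ∞ → MeasurableSet S → ν S ≤ A * μ S ^ (1 - p / Module.finrank ℝ E)) :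
    ∃ C : ℝ≥0, ∀ φ : E → ℝ, ContDiff ℝ 1 φ → HasCompactSupport φ →
      ∫⁻ x, ‖φ x‖ₑ ^ p ∂ν ≤ C * ∫⁻ x, ‖fderiv ℝ φ x‖ₑ ^ p ∂μ := by
  have hp0 : 0 < p := by linarith
  obtain ⟨C, hC⟩ := exists_meas_superlevel_rpow_le μ hp hpd
  refine ⟨2 ^ p * p.toNNReal * (A * C), fun φ hφ hcs => ?_⟩
  have hφm : Measurable φ := hφ.continuous.measurable
  set g : E → ℝ≥0∞ := fun x => ‖fderiv ℝ φ x‖ₑ ^ p with hg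
  have hgm : Measurable g := (measurable_fderiv ℝ φ).enorm.pow_const p
  have hm : ∀ t, MeasurableSet {x | t ≤ |φ x| ∧ |φ x| ≤ 2 * t} := fun t =>
    (measurableSet_le measurable_const hφ.continuous.abs.measurable).inter
      (measurableSet_le hφ.continuous.abs.measurable measurable_const)
  have hlevel : ∀ t : ℝ, 0 < t → ν {x | t < |φ x| / 2} * ENNReal.ofReal (t ^ (p - 1)) ≤
      A * C * ∫⁻ x, {t | t ≤ |φ x| ∧ |φ x| ≤ 2 * t}.indicator
        (fun t => ENNReal.ofReal t ^ (-1 : ℝ)) t * g x ∂μ := by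
    intro t ht
    have ht' : ENNReal.ofReal t ≠ 0 := by simpa using ht
    have hfin : μ {x | 2 * t ≤ |φ x|} ≠ ∞ := by
      refine ne_top_of_le_ne_top hcs.isCompact.measure_lt_top.ne (measure_mono fun x hx => ?_)
      refine subset_tsupport φ fun h0 => ?_
      rw [mem_ofPred_eq, h0, abs_zero] at hx
      linarith
    calc _ ≤ ν {x | 2 * t ≤ |φ x|} * ENNReal.ofReal (t ^ (p - 1)) := by
          gcongr with x
          intro hx
          linarith
      _ ≤ A * (C * ENNReal.ofReal t ^ (-p) * ∫⁻ x in {x | t ≤ |φ x| ∧ |φ x| ≤ 2 * t}, g x ∂μ) *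
          ENNReal.ofReal t ^ (p - 1) := by
          rw [← ENNReal.ofReal_rpow_of_pos ht (p := p - 1)]
          gcongr
          exact (hν _ hfin (measurableSet_le measurable_const hφ.continuous.abs.measurable)).trans
            (mul_le_mul_right (hC φ hφ hcs t ht) _)
      _ = A * C * (ENNReal.ofReal t ^ (-1 : ℝ) *
          ∫⁻ x in {x | t ≤ |φ x| ∧ |φ x| ≤ 2 * t}, g x ∂μ) := by
          rw [show (-1 : ℝ) = -p + (p - 1) by ring, ENNReal.rpow_add _ _ ht' ENNReal.ofReal_ne_top]
          ring
      _ = _ := by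
          congr 1
          rw [← lintegral_const_mul _ hgm, ← lintegral_indicator (hm t)]
          refine lintegral_congr fun x => ?_
          by_cases h : t ≤ |φ x| ∧ |φ x| ≤ 2 * t
          · rw [indicator_of_mem (by exact h), indicator_of_mem (by exact h)]
          · rw [indicator_of_notMem (by exact h), indicator_of_notMem (by exact h), zero_mul]
  have hs : MeasurableSet {z : ℝ × E | z.1 ≤ |φ z.2| ∧ |φ z.2| ≤ 2 * z.1} :=
    (measurableSet_le measurable_fst (hφm.comp measurable_snd).abs).inter
      (measurableSet_le (hφm.comp measurable_snd).abs (measurable_fst.const_mul 2))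
  have hjm : Measurable fun z : ℝ × E => {t | t ≤ |φ z.2| ∧ |φ z.2| ≤ 2 * t}.indicator
      (fun t => ENNReal.ofReal t ^ (-1 : ℝ)) z.1 * g z.2 := by
    refine Measurable.mul ?_ (by fun_prop)
    exact Measurable.indicator (f := fun z : ℝ × E => ENNReal.ofReal z.1 ^ (-1 : ℝ))
      (by fun_prop) hs
  have hφ2 : ∀ x, ‖φ x‖ₑ ^ p = 2 ^ p * ENNReal.ofReal ((|φ x| / 2) ^ p) := fun x => by
    rw [← ENNReal.ofReal_rpow_of_nonneg (by positivity) hp0.le,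
      ← ENNReal.mul_rpow_of_nonneg _ _ hp0.le, ← ENNReal.ofReal_ofNat, ← ENNReal.ofReal_mul two_pos.le,
      mul_div_cancel₀ _ two_ne_zero, ← Real.norm_eq_abs, ofReal_norm]
  calc ∫⁻ x, ‖φ x‖ₑ ^ p ∂ν = 2 ^ p * (ENNReal.ofReal p *
        ∫⁻ t in Ioi 0, ν {x | t < |φ x| / 2} * ENNReal.ofReal (t ^ (p - 1))) := by
        rw [← lintegral_rpow_eq_lintegral_meas_lt_mul ν (ae_of_all _ fun x => by positivity)
          (by fun_prop) hp0, ← lintegral_const_mul _ (by fun_prop)]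
        exact lintegral_congr hφ2
    _ ≤ 2 ^ p * (ENNReal.ofReal p * ∫⁻ t in Ioi 0,
        A * C * ∫⁻ x, {t | t ≤ |φ x| ∧ |φ x| ≤ 2 * t}.indicator
          (fun t => ENNReal.ofReal t ^ (-1 : ℝ)) t * g x ∂μ) := by
        gcongr 2 ^ p * (ENNReal.ofReal p * ?_)
        exact setLIntegral_mono' measurableSet_Ioi fun t ht => hlevel t ht
    _ = 2 ^ p * (ENNReal.ofReal p * (A * C * ∫⁻ x, (∫⁻ t in Ioi 0,
        {t | t ≤ |φ x| ∧ |φ x| ≤ 2 * t}.indicator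
          (fun t => ENNReal.ofReal t ^ (-1 : ℝ)) t * g x) ∂μ)) := by
        rw [lintegral_const_mul' _ _ (ENNReal.mul_ne_top ENNReal.coe_ne_top ENNReal.coe_ne_top),
          lintegral_lintegral_swap hjm.aemeasurable]
    _ ≤ 2 ^ p * (ENNReal.ofReal p * (A * C * ∫⁻ x, g x ∂μ)) := by
        gcongr 2 ^ p * (ENNReal.ofReal p * (A * C * ?_))
        refine lintegral_mono fun x => ?_
        have hgx : g x ≠ ∞ := ENNReal.rpow_ne_top_of_nonneg hp0.le enorm_ne_top
        rw [lintegral_mul_const' _ _ hgx]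
        exact mul_le_of_le_one_left' (setLIntegral_inv_le_one _)
    _ = _ := by
        push_cast [ENNReal.coe_rpow_of_nonneg _ hp0.le]
        change _ = 2 ^ p * ENNReal.ofReal p * _ * _
        ring

end Trace

section WeightedTrace

lemma Bornology.IsBounded.frontier_nonempty {E : Type*} [NormedAddCommGroup E] [NormedSpace ℝ E]
    [Nontrivial E] {Ω : Set E} (hb : Bornology.IsBounded Ω) (hne : Ω.Nonempty) :
    (frontier Ω).Nonempty := by
  rw [nonempty_iff_ne_empty]
  intro h
  rcases frontier_eq_empty_iff.1 h with rfl | rfl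
  · exact not_nonempty_empty hne
  · exact NormedSpace.unbounded_univ ℝ E hb

lemma IsOpen.infDist_frontier_pos {X : Type*} [PseudoMetricSpace X] {Ω : Set X} (hΩ : IsOpen Ω)
    (hfr : (frontier Ω).Nonempty) {x : X} (hx : x ∈ Ω) : 0 < infDist x (frontier Ω) := by
  refine (isClosed_frontier.notMem_iff_infDist_pos hfr).1 fun h => ?_
  rw [hΩ.frontier_eq] at h
  exact h.2 hx

/-- Hardy's inequality on a bounded open set with uniformly fat complement. -/
theorem UniformlyFat.exists_hardy {n : ℕ} {p c₀ r₀ : ℝ} {Ω : Set (EuclideanSpace ℝ (Fin n))}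
    (hfat : UniformlyFat n p c₀ r₀ Ωᶜ) (hn : 0 < n) (hp : 1 < p) (hc₀ : 0 < c₀) (hr₀ : 0 < r₀)
    (hb : Bornology.IsBounded Ω) (hopen : IsOpen Ω) (hne : Ω.Nonempty) :
    ∃ C : ℝ≥0, ∀ (L : ℝ≥0) (u : EuclideanSpace ℝ (Fin n) → ℝ), LipschitzWith L u →
      HasCompactSupport u → tsupport u ⊆ Ω →
      ∫⁻ x in Ω, ‖u x‖ₑ ^ p * ENNReal.ofReal (infDist x (frontier Ω)) ^ (-p) ≤
        C * ∫⁻ x in Ω, ‖fderiv ℝ u x‖ₑ ^ p := by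
  have : Nonempty (Fin n) := ⟨⟨0, hn⟩⟩
  have hfr := hb.frontier_nonempty hne
  obtain ⟨A, K, hK, h⟩ := hfat.exists_lintegral_sublevel_le hn hp.le hc₀ hr₀ hb hopen hfr
  exact exists_hardy_of_sublevel volume hopen (lipschitz_infDist_pt _)
    (fun x hx => hopen.infDist_frontier_pos hfr hx) (by linarith : 0 < K) hp h

/-- Trace inequality for weights in weak `L^{d/p}`, with the weight written as a power. -/
lemma exists_trace_of_weak_lebesgue {E : Type*} [NormedAddCommGroup E] [NormedSpace ℝ E]
    [FiniteDimensional ℝ E] [MeasurableSpace E] [BorelSpace E] (μ : Measure E) [μ.IsAddHaarMeasure]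
    {p γ M : ℝ} (hp : 1 ≤ p) (hpd : p < Module.finrank ℝ E) (hγ : 0 < γ) (hM : 0 < M) {Ω : Set E}
    (hfin : μ Ω ≠ ∞) {v : E → ℝ} (hv : Measurable v)
    (h : ∀ t : ℝ, 0 < t →
      t * (μ {x ∈ Ω | t < v x}).toReal ^ (γ / (Module.finrank ℝ E : ℝ)) ≤ M) :
    ∃ C : ℝ≥0, ∀ φ : E → ℝ, ContDiff ℝ 1 φ → HasCompactSupport φ →
      ∫⁻ x in Ω, ‖φ x‖ₑ ^ p * ENNReal.ofReal (max (v x) 0 ^ (p / γ)) ∂μ ≤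
        C * ∫⁻ x, ‖fderiv ℝ φ x‖ₑ ^ p ∂μ := by
  have hp0 : 0 < p := by linarith
  set d : ℝ := (Module.finrank ℝ E : ℝ) with hd
  have hd0 : 0 < d := hp0.trans hpd
  set w : E → ℝ := fun x => max (v x) 0 ^ (p / γ) with hw
  have hwm : Measurable w := by fun_prop
  have hlevel : ∀ t : ℝ, 0 < t →
      μ.restrict Ω {x | t < w x} ≤ ENNReal.ofReal ((M ^ (p / γ) / t) ^ (d / p)) := by
    intro t ht
    set s := t ^ (γ / p) with hs
    have hs0 : 0 < s := by positivity
    have hts : s ^ (p / γ) = t := by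
      rw [hs, ← Real.rpow_mul ht.le, div_mul_div_cancel₀ hp0.ne', div_self hγ.ne', Real.rpow_one]
    rw [Measure.restrict_apply (measurableSet_lt measurable_const hwm)]
    have hsub : {x | t < w x} ∩ Ω ⊆ {x ∈ Ω | s < v x} := by
      rintro x ⟨hx, hxΩ⟩
      refine ⟨hxΩ, ?_⟩
      have hx' : s ^ (p / γ) < max (v x) 0 ^ (p / γ) := by rwa [hts]
      have hlt := (Real.rpow_lt_rpow_iff hs0.le (le_max_right _ _) (by positivity)).1 hx'
      exact (lt_max_iff.1 hlt).resolve_right hs0.not_gt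
    have hfin' : μ {x ∈ Ω | s < v x} ≠ ∞ :=
      ne_top_of_le_ne_top hfin (measure_mono (sep_subset _ _))
    refine (measure_mono hsub).trans ?_
    rw [← ENNReal.ofReal_toReal hfin']
    refine ENNReal.ofReal_le_ofReal ?_
    set m := (μ {x ∈ Ω | s < v x}).toReal with hm
    have hm0 : 0 ≤ m := ENNReal.toReal_nonneg
    have hle : m ^ (γ / d) ≤ M / s := by
      rw [le_div_iff₀' hs0]
      exact h s hs0
    calc m = (m ^ (γ / d)) ^ (d / γ) := by
          rw [← Real.rpow_mul hm0, div_mul_div_cancel₀ hd0.ne', div_self hγ.ne', Real.rpow_one]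
      _ ≤ (M / s) ^ (d / γ) := by gcongr
      _ = _ := by
          have e : M ^ (p / γ) / t = (M / s) ^ (p / γ) := by
            rw [Real.div_rpow hM.le hs0.le, hts]
          rw [e, ← Real.rpow_mul (by positivity), div_mul_div_comm, mul_comm p d,
            mul_div_mul_right _ _ hp0.ne']
  obtain ⟨C, hC⟩ := exists_trace_of_measure_le μ hp hpd
    ((μ.restrict Ω).withDensity fun x => ENNReal.ofReal (w x))
    (M ^ (p / γ) * (d / p / (d / p - 1))).toNNReal fun S hS hSm => by
      rw [withDensity_apply _ hSm]
      refine (setLIntegral_le_of_meas_gt_le (μ.restrict Ω) hwm (fun x => by positivity)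
        (M := M ^ (p / γ)) (q := d / p) (by positivity) ((one_lt_div hp0).2 hpd) hlevel
        (ne_top_of_le_ne_top hS (Measure.restrict_apply_le _ _))).trans ?_
      rw [one_div_div]
      refine mul_le_mul_right (ENNReal.rpow_le_rpow (Measure.restrict_apply_le _ _) ?_) _
      rw [sub_nonneg, div_le_one hd0]
      exact hpd.le
  refine ⟨C, fun φ hφ hcs => le_of_eq_of_le ?_ (hC φ hφ hcs)⟩
  have hφm : Measurable φ := hφ.continuous.measurable
  rw [lintegral_withDensity_eq_lintegral_mul _ (by fun_prop) (by fun_prop)]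
  exact lintegral_congr fun x => mul_comm _ _

lemma lintegral_le_of_rpow_mul_rpow {α : Type*} [MeasurableSpace α] {μ : Measure α}
    {f g h : α → ℝ≥0∞} (hf : AEMeasurable f μ) (hg : AEMeasurable g μ) {θ : ℝ} (hθ0 : 0 ≤ θ)
    (hθ1 : θ ≤ 1) (hfgh : ∀ᵐ x ∂μ, h x ≤ f x ^ (1 - θ) * g x ^ θ) {a b G : ℝ≥0∞}
    (hfa : ∫⁻ x, f x ∂μ ≤ a * G) (hgb : ∫⁻ x, g x ∂μ ≤ b * G) :
    ∫⁻ x, h x ∂μ ≤ a ^ (1 - θ) * b ^ θ * G := by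
  have hθ' : 0 ≤ 1 - θ := sub_nonneg.2 hθ1
  calc _ ≤ ∫⁻ x, f x ^ (1 - θ) * g x ^ θ ∂μ := lintegral_mono_ae hfgh
    _ ≤ (∫⁻ x, f x ∂μ) ^ (1 - θ) * (∫⁻ x, g x ∂μ) ^ θ :=
      ENNReal.lintegral_mul_norm_pow_le hf hg hθ' hθ0 (by ring)
    _ ≤ (a * G) ^ (1 - θ) * (b * G) ^ θ := by gcongr
    _ = a ^ (1 - θ) * b ^ θ * (G ^ (1 - θ) * G ^ θ) := by
      rw [ENNReal.mul_rpow_of_nonneg _ _ hθ', ENNReal.mul_rpow_of_nonneg _ _ hθ0]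
      ring
    _ = _ := by rw [← ENNReal.rpow_add_of_nonneg _ _ hθ' hθ0, sub_add_cancel, ENNReal.rpow_one]

lemma ofReal_rpow_mul_rpow_mul_eq {y d v p γ : ℝ} (hd : 0 < d) (hv : 0 ≤ v) (hp : 0 < p)
    (hγ : 0 < γ) (hγp : γ ≤ p) :
    ENNReal.ofReal (|y| ^ p * (d ^ (-p + γ) * v)) =
      (‖y‖ₑ ^ p * ENNReal.ofReal d ^ (-p)) ^ (1 - γ / p) *
        (‖y‖ₑ ^ p * ENNReal.ofReal (max v 0 ^ (p / γ))) ^ (γ / p) := by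
  have hθ0 : 0 ≤ γ / p := by positivity
  have hθ' : 0 ≤ 1 - γ / p := sub_nonneg.2 ((div_le_one hp).2 hγp)
  have hv' : ENNReal.ofReal (max v 0 ^ (p / γ)) ^ (γ / p) = ENNReal.ofReal v := by
    rw [max_eq_left hv, ENNReal.ofReal_rpow_of_nonneg (by positivity) hθ0, ← Real.rpow_mul hv,
      div_mul_div_cancel₀ hγ.ne', div_self hp.ne', Real.rpow_one]
  rw [ENNReal.mul_rpow_of_nonneg _ _ hθ', ENNReal.mul_rpow_of_nonneg _ _ hθ0, hv',
    ENNReal.ofReal_mul (by positivity), ENNReal.ofReal_mul (by positivity),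
    ← ENNReal.ofReal_rpow_of_nonneg (abs_nonneg _) hp.le, ← Real.norm_eq_abs, ofReal_norm,
    ← ENNReal.ofReal_rpow_of_pos hd, ← ENNReal.rpow_mul (ENNReal.ofReal d),
    show -p * (1 - γ / p) = -p + γ by field_simp; ring]
  calc _ = ‖y‖ₑ ^ p * (ENNReal.ofReal d ^ (-p + γ) * ENNReal.ofReal v) := rfl
    _ = ((‖y‖ₑ ^ p) ^ (1 - γ / p) * (‖y‖ₑ ^ p) ^ (γ / p)) *
        (ENNReal.ofReal d ^ (-p + γ) * ENNReal.ofReal v) := by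
      rw [← ENNReal.rpow_add_of_nonneg _ _ hθ' hθ0, sub_add_cancel, ENNReal.rpow_one]
    _ = _ := by ring

end WeightedTrace

end

/-- **Corollary 4.6 (Euclidean case, `Q = n`):** if `ℝⁿ∖Ω` is uniformly `p`-fat,
`0 ≤ γ ≤ p`, and `v ≥ 0` lies in weak `L^{n/γ}(Ω)` (and in `L^∞(Ω)` when `γ = 0`), then
the trace inequality holds for the weight `V(x) = δ(x)^{-p+γ} v(x)`. -/
theorem trace_weak_lebesgue_weight (n : ℕ) (hn : 3 ≤ n) (p γ : ℝ)
    (hp : 1 < p) (hpn : p < n) (hγ0 : 0 ≤ γ) (hγp : γ ≤ p)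
    (Ω : Set (EuclideanSpace ℝ (Fin n)))
    (hb : Bornology.IsBounded Ω) (hconn : IsConnected Ω) (hopen : IsOpen Ω)
    (c₀ r₀ : ℝ) (hc₀ : 0 < c₀) (hr₀ : 0 < r₀) (hfat : UniformlyFat n p c₀ r₀ Ωᶜ)
    (v : EuclideanSpace ℝ (Fin n) → ℝ) (hv0 : ∀ x ∈ Ω, 0 ≤ v x) (hvm : Measurable v)
    (hweak : ∃ M : ℝ, 0 ≤ M ∧
      ((0 < γ → ∀ t : ℝ, 0 < t →
          t * (volume {x ∈ Ω | t < v x}).toReal ^ (γ / (n : ℝ)) ≤ M) ∧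
        (γ = 0 → ∀ x ∈ Ω, v x ≤ M))) :
    ∃ C : ℝ, 0 < C ∧
      ∀ φ : EuclideanSpace ℝ (Fin n) → ℝ, ContDiff ℝ (⊤ : ℕ∞) φ → HasCompactSupport φ →
        tsupport φ ⊆ Ω →
        (∫ x in Ω, |φ x| ^ p * (Metric.infDist x (frontier Ω) ^ (-p + γ) * v x)) ≤
          C * ∫ x in Ω, ‖fderiv ℝ φ x‖ ^ p := by
  have hp0 : 0 < p := by linarith
  have : Nonempty (Fin n) := ⟨⟨0, by omega⟩⟩
  obtain ⟨M, hM0, hMpos, hMzero⟩ := hweak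
  have hfr := hb.frontier_nonempty hconn.nonempty
  have hδ0 : ∀ x ∈ Ω, 0 < infDist x (frontier Ω) := fun x => hopen.infDist_frontier_pos hfr
  have hΩfin : volume Ω ≠ ∞ := hb.measure_lt_top.ne
  obtain ⟨H, hH⟩ := hfat.exists_hardy (by omega) hp hc₀ hr₀ hb hopen hconn.nonempty
  have key : ∃ C : ℝ≥0, ∀ φ : EuclideanSpace ℝ (Fin n) → ℝ, ContDiff ℝ (⊤ : ℕ∞) φ →
      HasCompactSupport φ → tsupport φ ⊆ Ω →
      ∫⁻ x in Ω, ENNReal.ofReal (|φ x| ^ p * (infDist x (frontier Ω) ^ (-p + γ) * v x)) ≤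
        C * ∫⁻ x in Ω, ‖fderiv ℝ φ x‖ₑ ^ p := by
    rcases hγ0.eq_or_lt with hγ | hγ
    · refine ⟨M.toNNReal * H, fun φ hφ hcs hsupp => ?_⟩
      obtain ⟨L, hL⟩ := hφ.lipschitzWith_of_hasCompactSupport hcs (by simp)
      calc _ ≤ ∫⁻ x in Ω, ENNReal.ofReal M *
            (‖φ x‖ₑ ^ p * ENNReal.ofReal (infDist x (frontier Ω)) ^ (-p)) := by
            refine setLIntegral_mono' hopen.measurableSet fun x hx => ?_
            have hδx := hδ0 x hx
            rw [← hγ, add_zero, ENNReal.ofReal_rpow_of_pos hδx, ← ofReal_norm,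
              ENNReal.ofReal_rpow_of_nonneg (norm_nonneg _) hp0.le,
              ← ENNReal.ofReal_mul (by positivity), ← ENNReal.ofReal_mul hM0, Real.norm_eq_abs,
              ← mul_assoc, mul_comm M]
            have := hMzero hγ.symm x hx
            gcongr
        _ ≤ ENNReal.ofReal M * (H * ∫⁻ x in Ω, ‖fderiv ℝ φ x‖ₑ ^ p) := by
            rw [lintegral_const_mul' _ _ ENNReal.ofReal_ne_top]
            exact mul_le_mul_right (hH L φ hL hcs hsupp) _
        _ = _ := by
            rw [ENNReal.coe_mul, mul_assoc]
            rfl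
    · obtain ⟨T, hT⟩ := exists_trace_of_weak_lebesgue
        (volume : Measure (EuclideanSpace ℝ (Fin n))) hp.le (by simpa using hpn) hγ
        (by positivity : 0 < M + 1) hΩfin hvm fun t ht => by
          rw [finrank_euclideanSpace_fin]
          exact (hMpos hγ t ht).trans (by linarith)
      have hθ1 : γ / p ≤ 1 := (div_le_one hp0).2 hγp
      refine ⟨H ^ (1 - γ / p) * T ^ (γ / p), fun φ hφ hcs hsupp => ?_⟩
      obtain ⟨L, hL⟩ := hφ.lipschitzWith_of_hasCompactSupport hcs (by simp)
      have hφm : Measurable φ := hφ.continuous.measurable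
      rw [ENNReal.coe_mul, ENNReal.coe_rpow_of_nonneg _ (sub_nonneg.2 hθ1),
        ENNReal.coe_rpow_of_nonneg _ (by positivity)]
      refine lintegral_le_of_rpow_mul_rpow
        (f := fun x => ‖φ x‖ₑ ^ p * ENNReal.ofReal (infDist x (frontier Ω)) ^ (-p))
        (g := fun x => ‖φ x‖ₑ ^ p * ENNReal.ofReal (max (v x) 0 ^ (p / γ)))
        ?_ ?_ (by positivity) hθ1 ?_ (hH L φ hL hcs hsupp) ?_
      · have : Measurable fun x => infDist x (frontier Ω) := measurable_infDist
        fun_prop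
      · fun_prop
      · filter_upwards [ae_restrict_mem hopen.measurableSet] with x hx
        exact (ofReal_rpow_mul_rpow_mul_eq (hδ0 x hx) (hv0 x hx) hp0 hγ hγp).le
      · rw [setLIntegral_enorm_fderiv_rpow_of_tsupport_subset _ hsupp hp0]
        exact hT φ (hφ.of_le (by simp)) hcs
  obtain ⟨C, hC⟩ := key
  refine ⟨C + 1, by positivity, fun φ hφ hcs hsupp => ?_⟩
  obtain ⟨L, hL⟩ := hφ.lipschitzWith_of_hasCompactSupport hcs (by simp)
  have hφm : Measurable φ := hφ.continuous.measurable
  have hG0 : 0 ≤ ∫ x in Ω, ‖fderiv ℝ φ x‖ ^ p := integral_nonneg fun x => by positivity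
  rw [integral_eq_lintegral_of_nonneg_ae]
  · refine ENNReal.toReal_le_of_le_ofReal (by positivity) ((hC φ hφ hcs hsupp).trans ?_)
    rw [← hL.ofReal_integral_norm_fderiv_rpow volume hΩfin hp0.le, ENNReal.ofReal_mul (by positivity)]
    gcongr
    rw [← ENNReal.ofReal_coe_nnreal]
    exact ENNReal.ofReal_le_ofReal (by linarith)
  · filter_upwards [ae_restrict_mem hopen.measurableSet] with x hx
    have := hδ0 x hx
    have := hv0 x hx
    positivity
  · have : Measurable fun x => infDist x (frontier Ω) := measurable_infDist
    exact Measurable.aestronglyMeasurable (by fun_prop)
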